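/- arXiv:1907.11967 — 2 statements merged into one kernel-verified Lean document; each statement's English description precedes it below -/
import Mathlib

section
/- Let q=q_KL. Then {dim_H(E∩(E+t)) : t∈T} = {0, log 3/log q_KL, log 3/(3 log q_KL)} ∪ { −(log 3/log q_KL)·∑_{i=1}^{n}(−1/2)^i : 1≤n<∞ }, where dim_H denotes Hausdorff dimension and E+t={x+t : x∈E}. -/
open scoped Pointwise ENNReal
open Filter

noncomputable section

/-- The digit set Ω₁ = {(0,0),(0,1),(1,0)} ⊆ ℝ². -/
def Omega1 : Set (ℝ × ℝ) := {((0:ℝ), (0:ℝ)), (0, 1), (1, 0)}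

/-- The digit set Ω₂ = Ω₁ − Ω₁ ⊆ ℝ². -/
def Omega2 : Set (ℝ × ℝ) :=
  {((0:ℝ), (0:ℝ)), (0, 1), (1, 0), (-1, 0), (-1, 1), (0, -1), (1, -1)}

/-- The Sierpinski gasket in base `q`. -/
def gasket (q : ℝ) : Set (ℝ × ℝ) :=
  {x | ∃ c : ℕ → ℝ × ℝ, (∀ i, c i ∈ Omega1) ∧ x = ∑' i, (q ^ (i + 1))⁻¹ • c i}

/-- `U_q`: points of `[-1/(q-1), 1/(q-1)]` having a unique `q`-expansion over `{-1,0,1}`. -/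
def uniqSet (q : ℝ) : Set ℝ :=
  {s | s ∈ Set.Icc (-(1 / (q - 1))) (1 / (q - 1)) ∧
    ∃! t : ℕ → ℝ, (∀ i, t i ∈ ({-1, 0, 1} : Set ℝ)) ∧ s = ∑' i, t i / q ^ (i + 1)}

/-- The set `T`. -/
def Tset (q : ℝ) : Set (ℝ × ℝ) :=
  {t | t ∈ gasket q - gasket q ∧ t.1 ∈ uniqSet q ∧ t.2 ∈ uniqSet q}

/-- The set `D_q` of Hausdorff dimensions of intersections. -/
def Dset (q : ℝ) : Set ℝ≥0∞ :=
  {d | ∃ t ∈ Tset q, d = dimH (gasket q ∩ ((· + t) '' gasket q))}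

/-- The words `w_n` over `{0,1,2}`: `klWord 0 = w₁ = 2`,
`w_{n+1} = (w_n ⟨reflection of w_n⟩)⁺`. -/
def klWord : ℕ → List ℕ
  | 0 => [2]
  | n + 1 =>
    let w := klWord n ++ (klWord n).map (fun x => 2 - x)
    w.dropLast ++ [w.getLast?.getD 0 + 1]

/-- `isKLBase n p`: `p ∈ (2,3)` and `1` has (greedy) expansion `w_n 0^∞` in base `p`
w.r.t. `{0,1,2}`, i.e. `p = q_n`. -/
def isKLBase (n : ℕ) (p : ℝ) : Prop :=
  p ∈ Set.Ioo (2 : ℝ) 3 ∧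
    (1 : ℝ) = ∑ i ∈ Finset.range (klWord (n - 1)).length,
      ((klWord (n - 1)).getD i 0 : ℝ) / p ^ (i + 1)

/-- `1` has a unique expansion in base `p` w.r.t. the digit set `{0,1,2}`. -/
def uniqueOneExp (p : ℝ) : Prop :=
  ∃! c : ℕ → ℕ, (∀ i, c i ≤ 2) ∧ (1 : ℝ) = ∑' i, (c i : ℝ) / p ^ (i + 1)

/-- The Thue–Morse sequence. -/
def tm : ℕ → ℕ
  | 0 => 0
  | n + 1 => if (n + 1) % 2 = 0 then tm ((n + 1) / 2) else 1 - tm ((n + 1) / 2)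
decreasing_by all_goals omega

/-- `λ_i = τ_i − τ_{i−1}` (for `i ≥ 1`). -/
def lam (i : ℕ) : ℤ := (tm i : ℤ) - (tm (i - 1) : ℤ)

/-- The word `ε_n = λ₁ ⋯ λ_{2^n}`. -/
def eps (n : ℕ) : List ℤ := (List.range (2 ^ n)).map fun i => lam (i + 1)

/-- Reflection of a word over `{-1,0,1}`: each digit `x` is replaced by `-x`. -/
def reflect (w : List ℤ) : List ℤ := w.map fun x => -x

/-- `w⁺`: the last digit is increased by `1`. -/
def plusOne (w : List ℤ) : List ℤ := w.dropLast ++ [w.getLast?.getD 0 + 1]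

/-- `w⁻`: the last digit is decreased by `1`. -/
def minusOne (w : List ℤ) : List ℤ := w.dropLast ++ [w.getLast?.getD 0 - 1]

/-- The periodic sequence `w^∞` (the `(j+1)`-st term is `per w j`). -/
def per (w : List ℤ) : ℕ → ℤ := fun j => w.getD (j % w.length) 0

/-- `EndsWith x s`: the sequence `x` ends with (has tail) the sequence `s`. -/
def EndsWith {α : Type*} (x s : ℕ → α) : Prop := ∃ k, ∀ j, x (j + k) = s j

/-- The digit set Ω₂ as a subset of ℤ × ℤ. -/
def Omega2Z : Set (ℤ × ℤ) :=
  {((0:ℤ), (0:ℤ)), (0, 1), (1, 0), (-1, 0), (-1, 1), (0, -1), (1, -1)}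

/-- `E_{n,m}^i = (σ^i((ε_n ε̄_n)^∞), (ε_m ε̄_m)^∞)` (the `(j+1)`-st term is `Eseq n m i j`). -/
def Eseq (n m i : ℕ) : ℕ → ℤ × ℤ := fun j =>
  (per (eps n ++ reflect (eps n)) (j + i), per (eps m ++ reflect (eps m)) j)

/-- `A_k = a₁ ⋯ a_{2^k}` where `a_i = λ_{2i−1}`. -/
def Aword (k : ℕ) : List ℤ := (List.range (2 ^ k)).map fun i => lam (2 * i + 1)

/-- `D_{k,k}^i = (σ^i((A_k Ā_k)^∞), (A_k Ā_k)^∞)`. -/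
def Dseq (k i : ℕ) : ℕ → ℤ × ℤ := fun j =>
  (per (Aword k ++ reflect (Aword k)) (j + i), per (Aword k ++ reflect (Aword k)) j)

/-- `U_q'`: the set of sequences over `{-1,0,1}` which are the unique `q`-expansion
of the number they represent. -/
def uniqSeqSet (q : ℝ) : Set (ℕ → ℤ) :=
  {t | (∀ i, t i ∈ ({-1, 0, 1} : Set ℤ)) ∧
    ∀ s : ℕ → ℤ, (∀ i, s i ∈ ({-1, 0, 1} : Set ℤ)) →
      (∑' i, (s i : ℝ) / q ^ (i + 1)) = (∑' i, (t i : ℝ) / q ^ (i + 1)) → s = t}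

/-- `ε_{n-1} ε̄_{n-1}`, with the convention `ε_{-1} ε̄_{-1} := 00`. -/
def epsPair : ℕ → List ℤ
  | 0 => [0, 0]
  | n + 1 => eps n ++ reflect (eps n)

/-- The finite prefix
`(ε_0 ε̄_0)^{j_0} (ε_0 ε̄_1)^{l_0} ⋯ (ε_{M-1} ε̄_{M-1})^{j_{M-1}} (ε_{M-1} ε̄_M)^{l_{M-1}}`. -/
def blockJL (j l : ℕ → ℕ) : ℕ → List ℤ
  | 0 => []
  | M + 1 => blockJL j l M
      ++ (List.replicate (j M) (eps M ++ reflect (eps M))).flatten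
      ++ (List.replicate (l M) (eps M ++ reflect (eps (M + 1)))).flatten

/-- The tail of `t` starting at some position `k` follows the pattern
`(ε_0 ε̄_0)^{j_0}(ε_0 ε̄_1)^{l_0}(ε_1 ε̄_1)^{j_1}(ε_1 ε̄_2)^{l_1}⋯`. -/
def TailFollows (t : ℕ → ℤ) (j l : ℕ → ℕ) : Prop :=
  ∃ k, ∀ M, ∀ i < (blockJL j l M).length, t (i + k) = (blockJL j l M).getD i 0

/-- As `TailFollows`, but for the reflection of the pattern. -/
def TailFollowsRefl (t : ℕ → ℤ) (j l : ℕ → ℕ) : Prop :=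
  ∃ k, ∀ M, ∀ i < (blockJL j l M).length, t (i + k) = -(blockJL j l M).getD i 0

/-- `a_n = 0 λ₁ ⋯ λ_{2^n−1}`. -/
def aword (n : ℕ) : List ℤ := 0 :: ((List.range (2 ^ n - 1)).map fun i => lam (i + 1))

/-- `b_n = (−1) λ₁ ⋯ λ_{2^n−1}`. -/
def bword (n : ℕ) : List ℤ := (-1) :: ((List.range (2 ^ n - 1)).map fun i => lam (i + 1))

/-- The transitions allowed by the matrix `A` on the alphabet `{a_n, b_n, ā_n, b̄_n}`:
`a→b, a→ā, b→ā, ā→a, ā→b̄, b̄→a`. -/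
def allowedTrans (n : ℕ) (u v : List ℤ) : Prop :=
  (u = aword n ∧ (v = bword n ∨ v = reflect (aword n))) ∨
  (u = bword n ∧ v = reflect (aword n)) ∨
  (u = reflect (aword n) ∧ (v = aword n ∨ v = reflect (bword n))) ∨
  (u = reflect (bword n) ∧ v = aword n)

/-! ### Lexicographic order and the Thue–Morse sequence -/

/-- Strict lexicographic order on sequences. -/
def LexLT {α : Type*} [LT α] (a b : ℕ → α) : Prop :=
  ∃ k, (∀ j < k, a j = b j) ∧ a k < b k

theorem lexLT_trichotomy {α : Type*} [LinearOrder α] (a b : ℕ → α) :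
    LexLT a b ∨ a = b ∨ LexLT b a := by
  classical
  by_cases h : a = b
  · exact Or.inr (Or.inl h)
  · have hne : ∃ k, a k ≠ b k := by
      by_contra! hc
      exact h (funext hc)
    have hmin : ∀ j < Nat.find hne, a j = b j := fun j hj => by
      simpa using Nat.find_min hne hj
    rcases lt_or_gt_of_ne (Nat.find_spec hne) with hlt | hlt
    · exact Or.inl ⟨_, hmin, hlt⟩
    · exact Or.inr (Or.inr ⟨_, fun j hj => (hmin j hj).symm, hlt⟩)

theorem LexLT.irrefl {α : Type*} [Preorder α] (a : ℕ → α) : ¬ LexLT a a := by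
  rintro ⟨k, -, hk⟩
  exact lt_irrefl _ hk

theorem LexLT.trans {α : Type*} [Preorder α] {a b c : ℕ → α} (hab : LexLT a b)
    (hbc : LexLT b c) : LexLT a c := by
  obtain ⟨k, hk, hk'⟩ := hab
  obtain ⟨l, hl, hlb⟩ := hbc
  rcases lt_trichotomy k l with h | h | h
  · exact ⟨k, fun j hj => (hk j hj).trans (hl j (hj.trans h)), (hl k h) ▸ hk'⟩
  · subst h
    exact ⟨k, fun j hj => (hk j hj).trans (hl j hj), hk'.trans hlb⟩
  · exact ⟨l, fun j hj => (hk j (hj.trans h)).trans (hl j hj), (hk l h) ▸ hlb⟩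

/-- The substitution `0 ↦ 01`, `1 ↦ 10`. -/
def doubling (s : ℕ → Bool) : ℕ → Bool := fun i => xor (s (i / 2)) (decide (i % 2 = 1))

@[simp] theorem doubling_even (s : ℕ → Bool) (i : ℕ) : doubling s (2 * i) = s i := by
  simp [doubling]

@[simp] theorem doubling_odd (s : ℕ → Bool) (i : ℕ) : doubling s (2 * i + 1) = !s i := by
  have : (2 * i + 1) / 2 = i := by omega
  simp [doubling, this]

theorem eq_doubling {s u : ℕ → Bool} (h0 : ∀ i, s (2 * i) = u i)
    (h1 : ∀ i, s (2 * i + 1) = !u i) : s = doubling u := by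
  funext i
  rcases Nat.even_or_odd' i with ⟨k, rfl | rfl⟩
  · simp [h0]
  · simp [h1]

/-- The Thue–Morse sequence with values in `Bool`. -/
def thueMorse : ℕ → Bool
  | 0 => false
  | n + 1 => xor (thueMorse ((n + 1) / 2)) (decide ((n + 1) % 2 = 1))
decreasing_by omega

theorem doubling_thueMorse : doubling thueMorse = thueMorse := by
  funext i
  cases i with
  | zero => simp [doubling]
  | succ n => rw [thueMorse]; rfl

theorem thueMorse_even (i : ℕ) : thueMorse (2 * i) = thueMorse i := by
  conv_lhs => rw [← doubling_thueMorse]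
  simp

theorem thueMorse_odd (i : ℕ) : thueMorse (2 * i + 1) = !thueMorse i := by
  conv_lhs => rw [← doubling_thueMorse]
  simp

theorem thueMorse_initial : thueMorse 0 = false ∧ thueMorse 1 = true ∧ thueMorse 2 = true ∧
    thueMorse 3 = false ∧ thueMorse 4 = true ∧ thueMorse 5 = false ∧ thueMorse 6 = false := by
  simp [thueMorse]

theorem LexLT.double {s u : ℕ → Bool} (h : LexLT s u) :
    LexLT (doubling s) (doubling u) := by
  obtain ⟨k, hk, hk'⟩ := h
  refine ⟨2 * k, fun j hj => ?_, by simpa using hk'⟩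
  have : j / 2 < k := by omega
  simp [doubling, hk _ this]

theorem lexLT_of_doubling {s u : ℕ → Bool} (h : LexLT (doubling s) (doubling u)) :
    LexLT s u := by
  rcases lexLT_trichotomy s u with h1 | h1 | h1
  · exact h1
  · exact absurd (h1 ▸ h) (LexLT.irrefl _)
  · exact absurd (h.trans h1.double) (LexLT.irrefl _)

/-- The tail of `s` starting at `n`, complemented if necessary so that it starts with `0`. -/
def normTail (s : ℕ → Bool) (n : ℕ) : ℕ → Bool := fun j => xor (s (n + j)) (s n)

theorem normTail_normTail (s : ℕ → Bool) (m n : ℕ) :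
    normTail (normTail s m) n = normTail s (m + n) := by
  funext j
  simp only [normTail, add_assoc]
  cases s (m + (n + j)) <;> cases s (m + n) <;> cases s m <;> rfl

theorem normTail_doubling (s : ℕ → Bool) (n : ℕ) :
    normTail (doubling s) (2 * n) = doubling (normTail s n) := by
  apply eq_doubling
  · intro i
    simp [normTail, ← mul_add]
  · intro i
    simp only [normTail, ← mul_add, ← add_assoc, doubling_even, doubling_odd]
    cases s (n + i) <;> cases s n <;> rfl

/-- All normalized tails of `s` are lexicographically at most the Thue–Morse sequence. -/
def LexAdm (s : ℕ → Bool) : Prop := ∀ n, ¬ LexLT thueMorse (normTail s n)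

theorem LexAdm.tail {s : ℕ → Bool} (h : LexAdm s) (m : ℕ) : LexAdm (normTail s m) := by
  intro n
  rw [normTail_normTail]
  exact h _

theorem LexAdm.of_doubling {s : ℕ → Bool} (h : LexAdm (doubling s)) : LexAdm s := by
  intro n hn
  apply h (2 * n)
  rw [normTail_doubling, ← doubling_thueMorse]
  exact hn.double

theorem LexAdm.not_0111 {s : ℕ → Bool} (h : LexAdm s) (n : ℕ) :
    ¬ (s (n + 1) = (!s n) ∧ s (n + 2) = (!s n) ∧ s (n + 3) = (!s n)) := by
  rintro ⟨h1, h2, h3⟩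
  refine h n ⟨3, fun j hj => ?_, ?_⟩
  · interval_cases j <;> simp [thueMorse_initial, normTail, *]
  · simp [thueMorse_initial, normTail, *]

theorem LexAdm.not_011011 {s : ℕ → Bool} (h : LexAdm s) (n : ℕ) :
    ¬ (s (n + 1) = (!s n) ∧ s (n + 2) = (!s n) ∧ s (n + 3) = s n ∧
      s (n + 4) = (!s n) ∧ s (n + 5) = (!s n)) := by
  rintro ⟨h1, h2, h3, h4, h5⟩
  refine h n ⟨5, fun j hj => ?_, ?_⟩
  · interval_cases j <;> simp [thueMorse_initial, normTail, *]
  · simp [thueMorse_initial, normTail, *]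

theorem LexAdm.not_0110101 {s : ℕ → Bool} (h : LexAdm s) (n : ℕ) :
    ¬ (s (n + 1) = (!s n) ∧ s (n + 2) = (!s n) ∧ s (n + 3) = s n ∧
      s (n + 4) = (!s n) ∧ s (n + 5) = s n ∧ s (n + 6) = (!s n)) := by
  rintro ⟨h1, h2, h3, h4, h5, h6⟩
  refine h n ⟨6, fun j hj => ?_, ?_⟩
  · interval_cases j <;> simp [thueMorse_initial, normTail, *]
  · simp [thueMorse_initial, normTail, *]

/-- After an occurrence of `011` (up to complement), an admissible sequence splits into the blocks
`01` and `10`. -/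
theorem LexAdm.pairs {u : ℕ → Bool} (h : LexAdm u) (h1 : u 1 = !u 0) (h2 : u 2 = !u 0) (k : ℕ) :
    u (2 * k + 1) = !u (2 * k) := by
  have key : ∀ k, (∀ i < k, u (2 * i + 1) = !u (2 * i)) ∧
      (∀ i, i + 2 < k → ¬ (u (2 * i + 2) = u (2 * i) ∧ u (2 * i + 4) = u (2 * i))) := by
    intro k
    induction k with
    | zero => simp
    | succ k ih =>
      obtain ⟨ih1, ih2⟩ := ih
      have hpair : u (2 * k + 1) = !u (2 * k) := by
        match k, ih1, ih2 with
        | 0, _, _ => exact h1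
        | 1, _, _ =>
          have := h.not_0111 0
          revert this h1 h2
          simp only [Nat.reduceMul, Nat.reduceAdd]
          cases u 0 <;> cases u 1 <;> cases u 2 <;> cases u 3 <;> simp
        | 2, ih1, _ =>
          have a0 := h.not_0111 2
          have a1 := h.not_011011 0
          have b1 := ih1 1 (by omega)
          revert a0 a1 b1 h1 h2
          simp only [Nat.reduceMul, Nat.reduceAdd]
          cases u 0 <;> cases u 1 <;> cases u 2 <;> cases u 3 <;> cases u 4 <;> cases u 5 <;> simp
        | k + 3, ih1, ih2 =>
          have e : 2 * (k + 3) = 2 * k + 6 := by ring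
          have b0 := ih1 k (by omega)
          have b1 := ih1 (k + 1) (by omega)
          have b2 := ih1 (k + 2) (by omega)
          have c := ih2 k (by omega)
          rw [show 2 * (k + 1) = 2 * k + 2 by ring] at b1
          rw [show 2 * (k + 2) = 2 * k + 4 by ring] at b2
          have a0 := h.not_0111 (2 * k + 4)
          have a1 := h.not_011011 (2 * k + 2)
          have a2 := h.not_0110101 (2 * k)
          rw [e]
          simp only [add_assoc, Nat.reduceAdd] at *
          revert b0 b1 b2 c a0 a1 a2
          generalize u (2 * k) = x0
          generalize u (2 * k + 1) = x1
          generalize u (2 * k + 2) = x2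
          generalize u (2 * k + 3) = x3
          generalize u (2 * k + 4) = x4
          generalize u (2 * k + 5) = x5
          generalize u (2 * k + 6) = x6
          generalize u (2 * k + 7) = x7
          rintro rfl c a2 rfl rfl
          revert c a2
          cases x0 <;> cases x2 <;> cases x4 <;> cases x6 <;> cases x7 <;> simp
      refine ⟨fun i hi => ?_, fun i hi => ?_⟩
      · rcases Nat.lt_succ_iff_lt_or_eq.1 hi with h' | rfl
        · exact ih1 i h'
        · exact hpair
      · rcases Nat.lt_succ_iff_lt_or_eq.1 hi with h' | h'
        · exact ih2 i h'
        · subst h'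
          match i, ih1, ih2, hpair with
          | 0, _, _, _ => grind
          | i + 1, ih1, ih2, hpair =>
            have b0 := ih1 i (by omega)
            have b1 := ih1 (i + 1) (by omega)
            have b2 := ih1 (i + 2) (by omega)
            have c := ih2 i (by omega)
            rw [show 2 * (i + 1) = 2 * i + 2 by ring] at b1
            rw [show 2 * (i + 2) = 2 * i + 4 by ring] at b2
            have a2 := h.not_0110101 (2 * i)
            rw [show 2 * (i + 1) = 2 * i + 2 by ring]
            simp only [add_assoc, Nat.reduceAdd] at *
            revert b0 b1 b2 c a2
            generalize u (2 * i) = x0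
            generalize u (2 * i + 1) = x1
            generalize u (2 * i + 2) = x2
            generalize u (2 * i + 3) = x3
            generalize u (2 * i + 4) = x4
            generalize u (2 * i + 5) = x5
            generalize u (2 * i + 6) = x6
            rintro rfl c a2 rfl rfl
            revert c a2
            revert x0 x2 x4 x6
            decide
  exact (key (k + 1)).1 k (Nat.lt_succ_self k)

theorem LexAdm.exists_doubling {u : ℕ → Bool} (h : LexAdm u) (h1 : u 1 = !u 0)
    (h2 : u 2 = !u 0) : ∃ s, u = doubling s :=
  ⟨fun k => u (2 * k), eq_doubling (fun _ => rfl) (h.pairs h1 h2)⟩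

/-- An admissible sequence is eventually constant, eventually alternating, or has a tail which is
(up to complement) the image of an admissible sequence under the doubling substitution. -/
theorem LexAdm.cases {s : ℕ → Bool} (h : LexAdm s) :
    (∃ m, ∀ i, s (m + i + 1) = s (m + i)) ∨ (∃ m, ∀ i, s (m + i + 1) = !s (m + i)) ∨
    ∃ m u, LexAdm u ∧ normTail s m = doubling u := by
  classical
  by_cases hc : ∃ m, ∀ i, s (m + i + 1) = s (m + i)
  · exact Or.inl hc
  by_cases ha : ∃ m, ∀ i, s (m + i + 1) = !s (m + i)
  · exact Or.inr (Or.inl ha)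
  refine Or.inr (Or.inr ?_)
  push Not at hc ha
  obtain ⟨n, hn⟩ := hc 0
  have hex := ha (0 + n + 1)
  have hm := Nat.find_spec hex
  set m := Nat.find hex with hmdef
  have hprev : s (0 + n + m + 1) = !s (0 + n + m) := by
    rcases Nat.eq_zero_or_pos m with h0 | h0
    · rw [h0]
      revert hn
      simp only [zero_add, add_zero]
      cases s (n + 1) <;> cases s n <;> simp
    · have := Nat.find_min hex (m := m - 1) (by omega)
      rw [show 0 + n + 1 + (m - 1) = 0 + n + m by omega] at this
      simpa only [ne_eq, not_not] using this
  have hadm := h.tail (0 + n + m)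
  obtain ⟨u, hu⟩ := hadm.exists_doubling
    (by simp only [normTail, add_zero, hprev]; cases s (0 + n + m) <;> rfl)
    (by
      have e : 0 + n + m + 2 = 0 + n + 1 + m + 1 := by ring
      have e' : 0 + n + m + 1 = 0 + n + 1 + m := by ring
      simp only [normTail, e, add_zero]
      rw [e'] at hprev
      revert hm hprev
      cases s (0 + n + 1 + m + 1) <;> cases s (0 + n + 1 + m) <;> cases s (0 + n + m) <;> simp)
  exact ⟨_, u, LexAdm.of_doubling (hu ▸ hadm), hu⟩

/-- No sequence which dominates all its normalized tails lies below the Thue–Morse sequence. -/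
theorem not_lexLT_thueMorse {s : ℕ → Bool} (h0 : s 0 = false) (h1 : s 1 = true)
    (hself : ∀ n, 1 ≤ n → LexLT (normTail s n) s) : ¬ LexLT s thueMorse := by
  rintro ⟨k, hk, hk'⟩
  induction k using Nat.strong_induction_on generalizing s with
  | _ k ih =>
    have hlt : LexLT s thueMorse := ⟨k, hk, hk'⟩
    have hadm : LexAdm s := by
      intro n hn
      rcases Nat.eq_zero_or_pos n with rfl | hpos
      · have e : normTail s 0 = s := by funext j; simp [normTail, h0]
        rw [e] at hn
        exact LexLT.irrefl _ (hn.trans hlt)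
      · exact LexLT.irrefl _ ((hn.trans (hself n hpos)).trans hlt)
    have h2 : s 2 = true := by
      by_contra h2
      simp only [Bool.not_eq_true] at h2
      obtain ⟨a, ha, ha'⟩ := hself 1 le_rfl
      have alt : ∀ j < a, s (j + 1) = !s j := by
        intro j hj
        have := ha j hj
        rw [normTail, h1, add_comm] at this
        rw [← this]
        simp
      simp only [normTail, h1, add_comm 1 a] at ha'
      have ha2 : s a = true ∧ s (a + 1) = true := by
        revert ha'
        cases s a <;> cases s (a + 1) <;> simp
      have ha3 : 3 ≤ a := by
        by_contra hlt
        interval_cases a <;> simp_all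
      obtain ⟨b, hb, hb'⟩ := hself 2 (by omega)
      simp only [normTail, h2, Bool.xor_false] at hb hb'
      rcases lt_trichotomy b (a - 1) with hlt | heq | hgt
      · have e1 := alt b (by omega)
        have e2 := alt (b + 1) (by omega)
        rw [show 2 + b = b + 1 + 1 by ring, e2, e1] at hb'
        simp at hb'
      · have e1 := alt b (by omega)
        rw [show 2 + b = a + 1 by omega, ha2.2] at hb'
        rw [show b + 1 = a by omega, ha2.1] at e1
        revert hb' e1
        cases s b <;> simp
      · have e0 := hb (a - 1) hgt
        have e1 := alt (a - 1) (by omega)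
        rw [show 2 + (a - 1) = a + 1 by omega, ha2.2] at e0
        rw [show a - 1 + 1 = a by omega, ha2.1, ← e0] at e1
        simp at e1
    obtain ⟨u, rfl⟩ := hadm.exists_doubling (by simp [h0, h1]) (by simp [h0, h2])
    have u0 : u 0 = false := (doubling_even u 0).symm.trans h0
    have u1 : u 1 = true := (doubling_even u 1).symm.trans h2
    have hk0 : k ≠ 0 := by
      rintro rfl
      simp [h0, thueMorse_initial] at hk'
    rcases Nat.even_or_odd' k with ⟨i, rfl | rfl⟩
    · refine ih i (by omega) u0 u1 (fun n hn => ?_) (fun j hj => ?_) ?_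
      · have := hself (2 * n) (by omega)
        rw [normTail_doubling] at this
        exact lexLT_of_doubling this
      · simpa [thueMorse_even] using hk (2 * j) (by omega)
      · simpa [thueMorse_even] using hk'
    · have := hk (2 * i) (by omega)
      rw [doubling_even, thueMorse_even] at this
      rw [doubling_odd, thueMorse_odd, this] at hk'
      exact absurd hk' (lt_irrefl _)

/-- All proper normalized tails of `s` are strictly below the Thue–Morse sequence. -/
def StrictLexAdm (s : ℕ → Bool) : Prop := ∀ n, 1 ≤ n → LexLT (normTail s n) thueMorse

theorem lexLT_thueMorse_of_initial {s : ℕ → Bool} (h0 : s 0 = false)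
    (h : ¬ (s 1 = true ∧ s 2 = true)) : LexLT s thueMorse := by
  obtain ⟨t0, t1, t2, -⟩ := thueMorse_initial
  by_cases h1 : s 1 = true
  · refine ⟨2, fun j hj => ?_, ?_⟩
    · interval_cases j <;> simp [*]
    · simp_all
  · refine ⟨1, fun j hj => ?_, ?_⟩
    · interval_cases j; simp [*]
    · simp_all

theorem lexLT_normTail_doubling_odd (s : ℕ → Bool) (n : ℕ) :
    LexLT (normTail (doubling s) (2 * n + 1)) thueMorse := by
  apply lexLT_thueMorse_of_initial
  · simp [normTail]
  · have e1 : doubling s (2 * n + 1 + 1) = s (n + 1) := by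
      rw [show 2 * n + 1 + 1 = 2 * (n + 1) by ring, doubling_even]
    have e2 : doubling s (2 * n + 1 + 2) = !s (n + 1) := by
      rw [show 2 * n + 1 + 2 = 2 * (n + 1) + 1 by ring, doubling_odd]
    simp only [normTail, e1, e2, doubling_odd]
    cases s n <;> cases s (n + 1) <;> simp

theorem StrictLexAdm.double {s : ℕ → Bool} (h : StrictLexAdm s) :
    StrictLexAdm (doubling s) := by
  intro n hn
  rcases Nat.even_or_odd' n with ⟨k, rfl | rfl⟩
  · rw [normTail_doubling, ← doubling_thueMorse]
    exact (h k (by omega)).double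
  · exact lexLT_normTail_doubling_odd s k

theorem strictLexAdm_thueMorse : StrictLexAdm thueMorse := by
  intro n
  induction n using Nat.strong_induction_on with
  | _ n ih =>
    intro hn
    rcases Nat.even_or_odd' n with ⟨k, rfl | rfl⟩
    · have := (ih k (by omega) (by omega)).double
      rwa [← normTail_doubling, doubling_thueMorse] at this
    · have := lexLT_normTail_doubling_odd thueMorse k
      rwa [doubling_thueMorse] at this

theorem strictLexAdm_alternating : StrictLexAdm (fun i => decide (i % 2 = 1)) := by
  intro n _
  apply lexLT_thueMorse_of_initial
  · simp [normTail]
  · have : (n + 2) % 2 = n % 2 := by omega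
    simp [normTail, this]

/-! ### Densities of sets of natural numbers -/

/-- The counting function of `p` stays within `(ε + o(1)) m` of `d m`. -/
def CloseDens (p : ℕ → Prop) [DecidablePred p] (d ε : ℝ) : Prop :=
  ∀ δ > ε, ∀ᶠ m : ℕ in atTop, |(Nat.count p m : ℝ) - d * m| ≤ δ * m

theorem eventually_const_le_mul {η : ℝ} (hη : 0 < η) (C : ℝ) :
    ∀ᶠ m : ℕ in atTop, C ≤ η * m :=
  (tendsto_natCast_atTop_atTop.const_mul_atTop hη).eventually_ge_atTop C

theorem CloseDens.of_tail_iff {p p' : ℕ → Prop} [DecidablePred p] [DecidablePred p'] {d ε : ℝ}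
    (hε : 0 ≤ ε) (h : CloseDens p' d ε) (a b : ℕ) (hpp : ∀ i, p (a + i) ↔ p' (b + i)) :
    CloseDens p d ε := by
  intro δ hδ
  set η := (δ - ε) / 2 with hη
  have hη0 : 0 < η := by rw [hη]; linarith
  have h1 := (tendsto_sub_atTop_nat a).eventually
    ((tendsto_add_atTop_nat b).eventually (h (ε + η) (by linarith)))
  have h2 := eventually_const_le_mul hη0
    ((a : ℝ) + b + |d| * a + |d| * b + (ε + η) * b + (ε + η) * a)
  filter_upwards [h1, h2, eventually_ge_atTop a] with m h1 h2 hm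
  obtain ⟨n, rfl⟩ := Nat.exists_eq_add_of_le hm
  rw [Nat.add_sub_cancel_left, add_comm n b] at h1
  rw [Nat.count_add] at h1 ⊢
  have hc : Nat.count (fun k => p (a + k)) n = Nat.count (fun k => p' (b + k)) n := by
    simp only [Nat.count_eq_card_filter_range, hpp]
  rw [hc]
  have ha : (Nat.count p a : ℝ) ≤ a := by exact_mod_cast Nat.count_le _
  have hb : (Nat.count p' b : ℝ) ≤ b := by exact_mod_cast Nat.count_le _
  have ha0 : (0 : ℝ) ≤ Nat.count p a := Nat.cast_nonneg _
  have hb0 : (0 : ℝ) ≤ Nat.count p' b := Nat.cast_nonneg _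
  push_cast at h1 h2 ⊢
  have hda : |d * a| = |d| * a := by rw [abs_mul, Nat.abs_cast]
  have hdb : |d * b| = |d| * b := by rw [abs_mul, Nat.abs_cast]
  have hda' := abs_le.1 hda.le
  have hdb' := abs_le.1 hdb.le
  have hab : 0 ≤ (ε + η) * a := by positivity
  rw [abs_le] at h1 ⊢
  have hδη : δ = ε + η + η := by rw [hη]; ring
  rw [hδη]
  constructor <;> linarith

theorem CloseDens.of_eventually_iff {p p' : ℕ → Prop} [DecidablePred p] [DecidablePred p']
    {d ε : ℝ} (hε : 0 ≤ ε) (h : CloseDens p' d ε) (K : ℕ) (hpp : ∀ i ≥ K, (p i ↔ p' i)) :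
    CloseDens p d ε :=
  h.of_tail_iff hε K K fun i => hpp _ (Nat.le_add_right K i)

theorem CloseDens.zero_of_eventually_not {p : ℕ → Prop} [DecidablePred p] (K : ℕ)
    (hp : ∀ i ≥ K, ¬ p i) : CloseDens p 0 0 := by
  refine CloseDens.of_eventually_iff (p' := fun _ => False) le_rfl ?_ K (by simpa using hp)
  intro δ hδ
  refine Eventually.of_forall fun m => ?_
  simp only [Nat.count_false]
  simp
  positivity

theorem CloseDens.one_of_eventually {p : ℕ → Prop} [DecidablePred p] (K : ℕ)
    (hp : ∀ i ≥ K, p i) : CloseDens p 1 0 := by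
  refine CloseDens.of_eventually_iff (p' := fun _ => True) le_rfl ?_ K (by simpa using hp)
  intro δ hδ
  refine Eventually.of_forall fun m => ?_
  simp only [Nat.count_true]
  simp
  positivity

theorem count_doubling (u : ℕ → Bool) (m : ℕ) :
    Nat.count (fun i => doubling u (i + 1) = doubling u i) (2 * m) +
      Nat.count (fun i => u (i + 1) = u i) m = m := by
  induction m with
  | zero => simp
  | succ m ih =>
    rw [show 2 * (m + 1) = 2 * m + 1 + 1 by ring, Nat.count_succ, Nat.count_succ, Nat.count_succ]
    have e : doubling u (2 * m + 1 + 1) = u (m + 1) := by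
      rw [show 2 * m + 1 + 1 = 2 * (m + 1) by ring, doubling_even]
    rw [e, doubling_odd, doubling_even]
    cases h : u (m + 1) <;> cases h' : u m <;> simp <;> omega

theorem CloseDens.double {u : ℕ → Bool} {d ε : ℝ} (hε : 0 ≤ ε)
    (h : CloseDens (fun i => u (i + 1) = u i) d ε) :
    CloseDens (fun i => doubling u (i + 1) = doubling u i) ((1 - d) / 2) (ε / 2) := by
  intro δ hδ
  set η := δ - ε / 2 with hη
  have hη0 : 0 < η := by rw [hη]; linarith
  have h1 := (Nat.tendsto_div_const_atTop (two_ne_zero)).eventually (h (ε + η) (by linarith))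
  have h2 := eventually_const_le_mul (half_pos hη0) (1 + |(1 - d) / 2|)
  filter_upwards [h1, h2] with M h1 h2
  have hcount := count_doubling u (M / 2)
  have hcount' : (Nat.count (fun i => doubling u (i + 1) = doubling u i) (2 * (M / 2)) : ℝ) +
      Nat.count (fun i => u (i + 1) = u i) (M / 2) = (M / 2 : ℕ) := by exact_mod_cast hcount
  set m := M / 2
  have hM : M = 2 * m ∨ M = 2 * m + 1 := by omega
  have hlo : Nat.count (fun i => doubling u (i + 1) = doubling u i) (2 * m) ≤
      Nat.count (fun i => doubling u (i + 1) = doubling u i) M :=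
    Nat.count_monotone _ (by omega)
  have hhi : Nat.count (fun i => doubling u (i + 1) = doubling u i) M ≤
      Nat.count (fun i => doubling u (i + 1) = doubling u i) (2 * m) + 1 := by
    rcases hM with hM | hM
    · rw [hM]; omega
    · rw [hM, Nat.count_succ]; split_ifs <;> omega
  have hlo' : (Nat.count (fun i => doubling u (i + 1) = doubling u i) (2 * m) : ℝ) ≤
      Nat.count (fun i => doubling u (i + 1) = doubling u i) M := by exact_mod_cast hlo
  have hhi' : (Nat.count (fun i => doubling u (i + 1) = doubling u i) M : ℝ) ≤
      Nat.count (fun i => doubling u (i + 1) = doubling u i) (2 * m) + 1 := by exact_mod_cast hhi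
  have hd := abs_le.1 (le_refl |(1 - d) / 2|)
  have hd0 := abs_nonneg ((1 - d) / 2)
  rw [abs_le] at h1 ⊢
  have hm : (m : ℝ) ≤ M / 2 := by
    have : 2 * m ≤ M := by omega
    have : 2 * (m : ℝ) ≤ M := by exact_mod_cast this
    linarith
  have hm1 : (ε + η) * m ≤ (ε + η) * (M / 2) := by gcongr
  have hδ' : δ = ε / 2 + η := by rw [hη]; ring
  rw [hδ']
  rcases hM with hM | hM
  · have hMr : (M : ℝ) = 2 * m := by exact_mod_cast hM
    constructor <;> nlinarith
  · have hMr : (M : ℝ) = 2 * m + 1 := by exact_mod_cast hM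
    constructor <;> nlinarith

/-- The partial sums `-∑_{i=1}^n (-1/2)^i`. -/
def altSum (n : ℕ) : ℝ := -∑ i ∈ Finset.Icc 1 n, (-(1 / 2) : ℝ) ^ i

theorem altSum_zero : altSum 0 = 0 := by simp [altSum]

theorem altSum_succ (n : ℕ) : altSum (n + 1) = (1 - altSum n) / 2 := by
  have h : ∀ n, altSum n = (1 - (-(1 / 2) : ℝ) ^ n) / 3 := by
    intro n
    induction n with
    | zero => simp [altSum]
    | succ n ih =>
      rw [altSum, Finset.sum_Icc_succ_top (by omega), neg_add, ← altSum, ih, pow_succ]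
      ring
  rw [h, h, pow_succ]
  ring

/-- The possible densities of the zeros. -/
def densVals : Set ℝ := {1, 1 / 3} ∪ Set.range altSum

theorem half_one_sub_mem_densVals {d : ℝ} (hd : d ∈ densVals) : (1 - d) / 2 ∈ densVals := by
  rcases hd with (rfl | rfl) | ⟨n, rfl⟩
  · exact Or.inr ⟨0, by simp [altSum_zero]⟩
  · exact Or.inl (Or.inr (by norm_num))
  · exact Or.inr ⟨n + 1, altSum_succ n⟩

theorem zero_mem_densVals : (0 : ℝ) ∈ densVals := Or.inr ⟨0, altSum_zero⟩

theorem closeDens_third_of_all {p : ℕ → Prop} [DecidablePred p] {d : ℝ}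
    (h : ∀ n : ℕ, CloseDens p d (2 / 3 / 2 ^ n)) : CloseDens p d 0 := by
  intro δ hδ
  obtain ⟨n, hn⟩ := exists_pow_lt_of_lt_one hδ (by norm_num : (1 / 2 : ℝ) < 1)
  refine h n δ (lt_of_le_of_lt ?_ hn)
  rw [one_div, inv_pow, div_eq_mul_inv]
  have : (0 : ℝ) < (2 ^ n)⁻¹ := by positivity
  linarith

theorem closeDens_third_zero (p : ℕ → Prop) [DecidablePred p] :
    CloseDens p (1 / 3) (2 / 3 / 2 ^ 0) := by
  intro δ hδ
  refine Eventually.of_forall fun m => ?_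
  have h1 : (Nat.count p m : ℝ) ≤ m := by exact_mod_cast Nat.count_le _
  have h0 : (0 : ℝ) ≤ Nat.count p m := Nat.cast_nonneg _
  have hm : (0 : ℝ) ≤ m := Nat.cast_nonneg _
  simp only [pow_zero, div_one] at hδ
  rw [abs_le]
  constructor <;> nlinarith

theorem closeDens_thueMorse :
    CloseDens (fun i => thueMorse (i + 1) = thueMorse i) (1 / 3) 0 := by
  apply closeDens_third_of_all
  intro n
  induction n with
  | zero => exact closeDens_third_zero _
  | succ n ih =>
    have := ih.double (by positivity)
    simp only [doubling_thueMorse] at this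
    convert this using 1 <;> [norm_num; (rw [pow_succ]; field_simp)]

theorem CloseDens.of_normTail {s u : ℕ → Bool} {m : ℕ} (hu : normTail s m = u) {d ε : ℝ}
    (hε : 0 ≤ ε) (h : CloseDens (fun i => u (i + 1) = u i) d ε) :
    CloseDens (fun i => s (i + 1) = s i) d ε := by
  refine h.of_tail_iff hε m 0 fun i => ?_
  subst hu
  simp only [normTail, zero_add, add_assoc, Bool.xor_left_inj]

/-- The zeros of the jump sequence of an admissible sequence have a density. -/
theorem LexAdm.exists_closeDens {s : ℕ → Bool} (hs : LexAdm s) :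
    ∃ d ∈ densVals, CloseDens (fun i => s (i + 1) = s i) d 0 := by
  have key : ∀ n : ℕ, ∀ s, LexAdm s →
      (∃ d ∈ densVals, CloseDens (fun i => s (i + 1) = s i) d 0) ∨
        CloseDens (fun i => s (i + 1) = s i) (1 / 3) (2 / 3 / 2 ^ n) := by
    intro n
    induction n with
    | zero => exact fun s _ => Or.inr (closeDens_third_zero _)
    | succ n ih =>
      intro s hs
      rcases hs.cases with ⟨m, hm⟩ | ⟨m, hm⟩ | ⟨m, u, hu, hmu⟩
      · refine Or.inl ⟨1, Or.inl (Or.inl rfl), CloseDens.one_of_eventually m fun i hi => ?_⟩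
        obtain ⟨j, rfl⟩ := Nat.exists_eq_add_of_le hi
        exact hm j
      · refine Or.inl ⟨0, zero_mem_densVals, CloseDens.zero_of_eventually_not m fun i hi => ?_⟩
        obtain ⟨j, rfl⟩ := Nat.exists_eq_add_of_le hi
        simp [hm j]
      · rcases ih u hu with ⟨d, hd, h⟩ | h
        · refine Or.inl ⟨_, half_one_sub_mem_densVals hd, ?_⟩
          have := h.double le_rfl
          rw [zero_div] at this
          exact this.of_normTail hmu le_rfl
        · right
          have := (h.double (by positivity)).of_normTail hmu (by positivity)
          convert this using 1 <;> [norm_num; (rw [pow_succ]; field_simp)]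
  by_cases hex : ∃ d ∈ densVals, CloseDens (fun i => s (i + 1) = s i) d 0
  · exact hex
  · exact ⟨1 / 3, Or.inl (Or.inr rfl),
      closeDens_third_of_all fun n => (key n s hs).resolve_left hex⟩

/-! ### Jump sequences -/

/-- The sequence of differences of a binary sequence. -/
def jump (s : ℕ → Bool) : ℕ → ℤ := fun i => ((s (i + 1)).toNat : ℤ) - (s i).toNat

theorem jump_eq_zero_iff (s : ℕ → Bool) (i : ℕ) : jump s i = 0 ↔ s (i + 1) = s i := by
  simp only [jump]
  cases s (i + 1) <;> cases s i <;> simp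

theorem jump_add (s : ℕ → Bool) (k i : ℕ) : jump s (k + i) = jump (fun j => s (k + j)) i := rfl

theorem jump_mem (s : ℕ → Bool) (i : ℕ) : jump s i ∈ ({-1, 0, 1} : Set ℤ) := by
  simp only [jump]
  cases s (i + 1) <;> cases s i <;> simp

/-- A sequence over `{-1, 0, 1}` which is constantly `1`, constantly `-1`, or has a tail which is
the jump sequence of an admissible sequence. -/
def JumpShape (t : ℕ → ℤ) : Prop :=
  (∀ i, t i = 1) ∨ (∀ i, t i = -1) ∨ ∃ k s, LexAdm s ∧ ∀ i, t (k + i) = jump s i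

theorem JumpShape.exists_closeDens {t : ℕ → ℤ} (h : JumpShape t) :
    ∃ d ∈ densVals, CloseDens (fun i => t i = 0) d 0 := by
  rcases h with h | h | ⟨k, s, hs, h⟩
  · exact ⟨0, zero_mem_densVals, CloseDens.zero_of_eventually_not 0 fun i _ => by simp [h]⟩
  · exact ⟨0, zero_mem_densVals, CloseDens.zero_of_eventually_not 0 fun i _ => by simp [h]⟩
  · obtain ⟨d, hd, hs⟩ := hs.exists_closeDens
    refine ⟨d, hd, hs.of_tail_iff le_rfl k 0 fun i => ?_⟩
    rw [h, zero_add, jump_eq_zero_iff]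

theorem JumpShape.cases {t : ℕ → ℤ} (h : JumpShape t) :
    (∃ K, ∀ i ≥ K, t i = 0) ∨ (∃ K, ∀ i ≥ K, t i ≠ 0) ∨
    ∃ K s, (∀ i, t (K + i) = jump s i) ∧ ∀ i, s (2 * i + 1) = !s (2 * i) := by
  rcases h with h | h | ⟨k, s, hs, h⟩
  · exact Or.inr (Or.inl ⟨0, fun i _ => by simp [h]⟩)
  · exact Or.inr (Or.inl ⟨0, fun i _ => by simp [h]⟩)
  · rcases hs.cases with ⟨m, hm⟩ | ⟨m, hm⟩ | ⟨m, u, -, hmu⟩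
    · refine Or.inl ⟨k + m, fun i hi => ?_⟩
      obtain ⟨j, rfl⟩ := Nat.exists_eq_add_of_le hi
      rw [add_assoc, h, jump_eq_zero_iff, hm]
    · refine Or.inr (Or.inl ⟨k + m, fun i hi => ?_⟩)
      obtain ⟨j, rfl⟩ := Nat.exists_eq_add_of_le hi
      rw [add_assoc, h, Ne, jump_eq_zero_iff, hm]
      simp
    · refine Or.inr (Or.inr ⟨k + m, fun j => s (m + j), fun i => ?_, fun i => ?_⟩)
      · rw [add_assoc, h, jump_add]
      · change s (m + (2 * i + 1)) = !s (m + 2 * i)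
        have h0 := congrFun hmu (2 * i)
        have h1 := congrFun hmu (2 * i + 1)
        rw [doubling_even] at h0
        rw [doubling_odd, ← h0] at h1
        simp only [normTail] at h1
        revert h1
        cases s (m + (2 * i + 1)) <;> cases s (m + 2 * i) <;> cases s m <;> simp

theorem exists_closeDens_joint {t t' : ℕ → ℤ} (h : JumpShape t) (h' : JumpShape t')
    (hno : ∀ i, ¬ (t i = 1 ∧ t' i = -1) ∧ ¬ (t i = -1 ∧ t' i = 1)) :
    ∃ d ∈ densVals, CloseDens (fun i => t i = 0 ∧ t' i = 0) d 0 := by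
  obtain ⟨d, hd, hdens⟩ := h.exists_closeDens
  obtain ⟨d', hd', hdens'⟩ := h'.exists_closeDens
  rcases h.cases with ⟨K, hK⟩ | ⟨K, hK⟩ | ⟨K, s, hs, hsp⟩
  · exact ⟨d', hd', hdens'.of_eventually_iff le_rfl K fun i hi => by simp [hK i hi]⟩
  · exact ⟨0, zero_mem_densVals, CloseDens.zero_of_eventually_not K fun i hi => by simp [hK i hi]⟩
  rcases h'.cases with ⟨K', hK'⟩ | ⟨K', hK'⟩ | ⟨K', s', hs', hsp'⟩
  · exact ⟨d, hd, hdens.of_eventually_iff le_rfl K' fun i hi => by simp [hK' i hi]⟩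
  · exact ⟨0, zero_mem_densVals,
      CloseDens.zero_of_eventually_not K' fun i hi => by simp [hK' i hi]⟩
  have ht : ∀ a, t (K + 2 * a) ≠ 0 := fun a => by
    rw [hs, Ne, jump_eq_zero_iff, hsp]
    simp
  have ht' : ∀ a, t' (K' + 2 * a) ≠ 0 := fun a => by
    rw [hs', Ne, jump_eq_zero_iff, hsp']
    simp
  by_cases hpar : K % 2 = K' % 2
  · have heq : ∀ a b, K + 2 * a = K' + 2 * b → s (2 * a) = s' (2 * b) := by
      intro a b hab
      have n := hno (K + 2 * a)
      rw [hs] at n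
      rw [hab, hs'] at n
      simp only [jump, hsp, hsp'] at n
      revert n
      cases s (2 * a) <;> cases s' (2 * b) <;> simp
    refine ⟨d, hd, hdens.of_eventually_iff le_rfl (K + K') fun i hi => ?_⟩
    have hiff : t i = 0 ↔ t' i = 0 := by
      rcases Nat.even_or_odd' (i - K) with ⟨a, ha | ha⟩
      · obtain ⟨b, hb⟩ : ∃ b, i = K' + 2 * b := ⟨(i - K') / 2, by omega⟩
        have h1 := ht a
        rw [show K + 2 * a = i by omega] at h1
        have h2 := ht' b
        rw [← hb] at h2
        simp [h1, h2]
      · obtain ⟨b, hb⟩ : ∃ b, i = K' + (2 * b + 1) := ⟨(i - K') / 2, by omega⟩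
        have hi' : i = K + (2 * a + 1) := by omega
        have e1 := hs (2 * a + 1)
        have e2 := hs' (2 * b + 1)
        rw [← hi'] at e1
        rw [← hb] at e2
        rw [e1, e2, jump_eq_zero_iff, jump_eq_zero_iff, hsp, hsp', heq a b (by omega)]
        have := heq (a + 1) (b + 1) (by omega)
        rw [mul_add, mul_add] at this
        rw [show s (2 * a + 1 + 1) = s' (2 * b + 1 + 1) from this]
    rw [← hiff, and_self]
  · refine ⟨0, zero_mem_densVals, CloseDens.zero_of_eventually_not (K + K') fun i hi => ?_⟩
    rintro ⟨h0, h0'⟩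
    rcases Nat.even_or_odd' (i - K) with ⟨a, ha | ha⟩
    · apply ht a
      rwa [show K + 2 * a = i by omega]
    · apply ht' ((i - K') / 2)
      rwa [show K' + 2 * ((i - K') / 2) = i by omega]

/-! ### Lexicographic conditions on sequences over `{-1, 0, 1}` -/

theorem LexLT.jump {a b : ℕ → Bool} (h0 : a 0 = b 0) (h : LexLT a b) :
    LexLT (jump a) (jump b) := by
  obtain ⟨k, hk, hk'⟩ := h
  cases k with
  | zero => rw [h0] at hk'; exact absurd hk' (lt_irrefl _)
  | succ k =>
    refine ⟨k, fun j hj => ?_, ?_⟩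
    · simp only [_root_.jump, hk j (by omega), hk (j + 1) (by omega)]
    · simp only [_root_.jump, hk k (by omega)]
      rw [Bool.lt_iff] at hk'
      simp [hk'.1, hk'.2]

theorem LexLT.of_jump {a b : ℕ → Bool} (h0 : a 0 = b 0)
    (h : LexLT (_root_.jump a) (_root_.jump b)) :
    LexLT a b := by
  obtain ⟨k, hk, hk'⟩ := h
  have key : ∀ j ≤ k, a j = b j := by
    intro j
    induction j with
    | zero => exact fun _ => h0
    | succ j ih =>
      intro hj
      have h1 := ih (by omega)
      have h2 := hk j (by omega)
      revert h2
      simp only [_root_.jump, h1]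
      cases a (j + 1) <;> cases b (j + 1) <;> cases b j <;> simp
  refine ⟨k + 1, fun j hj => key j (by omega), ?_⟩
  have h1 := key k le_rfl
  revert hk'
  simp only [_root_.jump, h1]
  cases a (k + 1) <;> cases b (k + 1) <;> simp

theorem jump_normTail_of_false {s : ℕ → Bool} {n : ℕ} (h : s n = false) :
    jump (normTail s n) = fun i => jump s (n + i) := by
  funext i
  simp [jump, normTail, h, add_assoc]

theorem jump_normTail_of_true {s : ℕ → Bool} {n : ℕ} (h : s n = true) :
    jump (normTail s n) = fun i => -jump s (n + i) := by
  funext i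
  simp only [jump, normTail, h, add_assoc]
  cases s (n + (i + 1)) <;> cases s (n + i) <;> simp

/-- The quasi-greedy sequence at the Komornik–Loreti constant, over the digits `{-1, 0, 1}`. -/
def klSeq : ℕ → ℤ := jump thueMorse

theorem klSeq_initial : klSeq 0 = 1 ∧ klSeq 1 = 0 ∧ klSeq 2 = -1 := by
  obtain ⟨t0, t1, t2, t3, -⟩ := thueMorse_initial
  simp [klSeq, jump, t0, t1, t2, t3]

/-- The tails of `t` following a digit which is not maximal do not exceed `klSeq`, and dually. -/
def KLAdm (t : ℕ → ℤ) : Prop := ∀ n,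
  (t n < 1 → ¬ LexLT klSeq (fun i => t (n + 1 + i))) ∧
  (-1 < t n → ¬ LexLT klSeq (fun i => -t (n + 1 + i)))

theorem KLAdm.neg {t : ℕ → ℤ} (h : KLAdm t) : KLAdm (fun i => -t i) := by
  intro n
  refine ⟨fun hn => (h n).2 (by simp only at hn; omega), fun hn => ?_⟩
  simp only [neg_neg]
  exact (h n).1 (by simp only at hn; omega)

theorem KLAdm.tail {t : ℕ → ℤ} (h : KLAdm t) (k : ℕ) : KLAdm (fun i => t (k + i)) := by
  intro n
  simpa only [add_assoc] using h (k + n)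

theorem KLAdm.local_rule {t : ℕ → ℤ} (ht : ∀ i, t i ∈ ({-1, 0, 1} : Set ℤ)) (h : KLAdm t) {n : ℕ}
    (h0 : t n < 1) (h1 : t (n + 1) = 1) :
    t (n + 2) = -1 ∨ (t (n + 2) = 0 ∧ t (n + 3) = -1) := by
  obtain ⟨l0, l1, l2⟩ := klSeq_initial
  have h := (h n).1 h0
  have h2 : ¬ 0 < t (n + 2) := fun h2 => h ⟨1, fun j hj => by
    interval_cases j; simp [l0, h1], by simpa [l1, add_assoc] using h2⟩
  have h3 : t (n + 2) = 0 → ¬ -1 < t (n + 3) := fun e h2 => h ⟨2, fun j hj => by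
    interval_cases j <;> simp [l0, l1, h1, e, add_assoc], by simpa [l2, add_assoc] using h2⟩
  have m2 := ht (n + 2)
  have m3 := ht (n + 3)
  simp only [Set.mem_insert_iff, Set.mem_singleton_iff] at m2 m3
  omega

theorem KLAdm.exists_jump {u : ℕ → ℤ} (hu : ∀ i, u i ∈ ({-1, 0, 1} : Set ℤ)) (h : KLAdm u)
    (h0 : u 0 < 1) (h1 : u 1 = 1) :
    ∃ s : ℕ → Bool, s 0 = false ∧ (∀ i, u (i + 1) = jump s i) ∧ LexAdm s := by
  have hneg : ∀ i, -u i ∈ ({-1, 0, 1} : Set ℤ) := fun i => by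
    have := hu i
    simp only [Set.mem_insert_iff, Set.mem_singleton_iff] at this ⊢
    omega
  have rule : ∀ i, u i < 1 → u (i + 1) = 1 →
      u (i + 2) = -1 ∨ (u (i + 2) = 0 ∧ u (i + 3) = -1) := fun i => h.local_rule hu
  have rule' : ∀ i, -1 < u i → u (i + 1) = -1 →
      u (i + 2) = 1 ∨ (u (i + 2) = 0 ∧ u (i + 3) = 1) := fun i a b => by
    have := h.neg.local_rule (n := i) hneg (by omega) (by omega)
    omega
  have inv : ∀ i, (u (i + 1) = 1 ∧ u i < 1) ∨ (u (i + 1) = -1 ∧ -1 < u i) ∨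
      (u (i + 1) = 0 ∧ u i = 1 ∧ u (i + 2) = -1) ∨
      (u (i + 1) = 0 ∧ u i = -1 ∧ u (i + 2) = 1) := by
    intro i
    induction i with
    | zero => exact Or.inl ⟨h1, h0⟩
    | succ i ih =>
      have r := rule i
      have r' := rule' i
      simp only [add_assoc, Nat.reduceAdd] at *
      omega
  let s : ℕ → Bool := fun n =>
    match n with
    | 0 => false
    | i + 1 => decide (u (i + 1) = 1 ∨ (u (i + 1) = 0 ∧ u i = 1))
  have hs0 : s 0 = false := rfl
  have hs : ∀ i, s (i + 1) = decide (u (i + 1) = 1 ∨ (u (i + 1) = 0 ∧ u i = 1)) := fun _ => rfl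
  clear_value s
  have hnat : ∀ i, ((s (i + 1)).toNat : ℤ) =
      if u (i + 1) = 1 ∨ (u (i + 1) = 0 ∧ u i = 1) then 1 else 0 := fun i => by
    rw [hs]
    split_ifs with hc <;> simp [hc]
  have hjump : ∀ i, u (i + 1) = jump s i := by
    intro i
    cases i with
    | zero => simp [jump, hs, hs0, h1]
    | succ i =>
      rw [jump, hnat, hnat]
      have q := inv i
      have r := rule i
      have r' := rule' i
      simp only [add_assoc, Nat.reduceAdd] at *
      split_ifs <;> omega
  refine ⟨s, hs0, hjump, fun n hn => ?_⟩
  have hn := hn.jump (by simp [normTail, thueMorse_initial])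
  cases hsn : s n with
  | false =>
    rw [jump_normTail_of_false hsn] at hn
    refine (h n).1 ?_ (by simpa only [klSeq, add_right_comm n 1, hjump] using hn)
    cases n with
    | zero => exact h0
    | succ n =>
      rw [hs, decide_eq_false_iff_not] at hsn
      have := hu (n + 1)
      simp only [Set.mem_insert_iff, Set.mem_singleton_iff] at this
      omega
  | true =>
    rw [jump_normTail_of_true hsn] at hn
    refine (h n).2 ?_ (by simpa only [klSeq, add_right_comm n 1, hjump] using hn)
    cases n with
    | zero => simp [hs0] at hsn
    | succ n =>
      rw [hs, decide_eq_true_iff] at hsn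
      omega

theorem lexAdm_const : LexAdm (fun _ => false) := by
  rintro n ⟨k, -, hk⟩
  simp [normTail, Bool.lt_iff] at hk

theorem LexAdm.compl {s : ℕ → Bool} (h : LexAdm s) : LexAdm (fun i => !s i) := by
  intro n
  have : normTail (fun i => !s i) n = normTail s n := by
    funext j
    simp [normTail]
  rw [this]
  exact h n

theorem jump_compl (s : ℕ → Bool) (i : ℕ) : jump (fun i => !s i) i = -jump s i := by
  simp only [jump]
  cases s (i + 1) <;> cases s i <;> simp

theorem KLAdm.jumpShape {t : ℕ → ℤ} (ht : ∀ i, t i ∈ ({-1, 0, 1} : Set ℤ)) (h : KLAdm t) :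
    JumpShape t := by
  have ht' : ∀ i, t i = -1 ∨ t i = 0 ∨ t i = 1 := fun i => by simpa using ht i
  by_cases hc : ∃ k, t (k + 1) ≠ 0 ∧ t (k + 1) ≠ t k
  · obtain ⟨k, hk0, hk⟩ := hc
    rcases ht' (k + 1) with h1 | h1 | h1
    · obtain ⟨s, -, hs, hadm⟩ := (h.tail k).neg.exists_jump (fun i => by
        have := ht' (k + i)
        simp only [Set.mem_insert_iff, Set.mem_singleton_iff]
        omega) (by have := ht' k; simp only [add_zero]; omega) (by simp [h1])
      refine Or.inr (Or.inr ⟨k + 1, _, hadm.compl, fun i => ?_⟩)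
      rw [jump_compl, ← hs, neg_neg, add_right_comm, add_assoc]
    · exact absurd h1 hk0
    · obtain ⟨s, -, hs, hadm⟩ := (h.tail k).exists_jump (fun i => ht _)
        (by have := ht' k; simp only [add_zero]; omega) (by simp [h1])
      refine Or.inr (Or.inr ⟨k + 1, _, hadm, fun i => ?_⟩)
      rw [← hs, add_right_comm, add_assoc]
  · push Not at hc
    by_cases hz : ∃ k, t k = 0
    · obtain ⟨k, hk⟩ := hz
      refine Or.inr (Or.inr ⟨k, _, lexAdm_const, fun i => ?_⟩)
      simp only [jump, sub_self]
      induction i with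
      | zero => exact hk
      | succ i ih =>
        have := hc (k + i)
        rw [ih] at this
        by_contra hne
        exact hne (this hne)
    · push Not at hz
      have hconst : ∀ i, t i = t 0 := by
        intro i
        induction i with
        | zero => rfl
        | succ i ih => rw [hc i (hz _), ih]
      rcases ht' 0 with h0 | h0 | h0
      · exact Or.inr (Or.inl fun i => (hconst i).trans h0)
      · exact absurd h0 (hz 0)
      · exact Or.inl fun i => (hconst i).trans h0

/-- All proper tails of `t` and of `-t` are smaller than `klSeq`. -/
def StrictKLAdm (t : ℕ → ℤ) : Prop := ∀ n,
  LexLT (fun i => t (n + 1 + i)) klSeq ∧ LexLT (fun i => -t (n + 1 + i)) klSeq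

theorem StrictLexAdm.strictKLAdm {s : ℕ → Bool} (h : StrictLexAdm s) : StrictKLAdm (jump s) := by
  intro n
  have hn := (h (n + 1) (by omega)).jump (by simp [normTail, thueMorse_initial])
  have l0 := klSeq_initial.1
  cases hs : s (n + 1) with
  | false =>
    rw [jump_normTail_of_false hs] at hn
    refine ⟨hn, 0, by simp, ?_⟩
    simp only [l0, add_zero, jump, hs]
    cases s (n + 1 + 1) <;> simp
  | true =>
    rw [jump_normTail_of_true hs] at hn
    refine ⟨⟨0, by simp, ?_⟩, hn⟩
    simp only [l0, add_zero, jump, hs]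
    cases s (n + 1 + 1) <;> simp

theorem strictLexAdm_const : StrictLexAdm (fun _ => false) := fun _ _ =>
  lexLT_thueMorse_of_initial (by simp [normTail]) (by simp [normTail])

theorem strictKLAdm_klSeq : StrictKLAdm klSeq := strictLexAdm_thueMorse.strictKLAdm

/-- `klSeq` is the smallest sequence dominating its own tails and their reflections. -/
theorem not_lexLT_klSeq {d : ℕ → ℤ} (hd : ∀ i, d i ∈ ({-1, 0, 1} : Set ℤ))
    (h1 : ∀ n, d n < 1 → LexLT (fun i => d (n + 1 + i)) d)
    (h2 : ∀ n, -1 < d n → LexLT (fun i => -d (n + 1 + i)) d) : ¬ LexLT d klSeq := by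
  have hd' : ∀ i, d i = -1 ∨ d i = 0 ∨ d i = 1 := fun i => by simpa using hd i
  have le_of : ∀ a b : ℕ → ℤ, LexLT a b → a 0 ≤ b 0 := by
    rintro a b ⟨k, hk, hk'⟩
    rcases Nat.eq_zero_or_pos k with rfl | hpos
    · exact hk'.le
    · exact (hk 0 hpos).le
  have hd0 : d 0 = 1 := by
    by_contra hne
    have hconst : ∀ n, d n = d 0 := by
      intro n
      induction n with
      | zero => rfl
      | succ n ih =>
        have a := fun h => le_of _ _ (h1 n h)
        have b := fun h => le_of _ _ (h2 n h)
        have c := hd' 0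
        have c' := hd' (n + 1)
        simp only [add_zero] at a b
        omega
    have := h1 0 (by have := hd' 0; omega)
    obtain ⟨k, -, hk⟩ := this
    simp only [hconst, lt_irrefl] at hk
  intro hlt
  let u : ℕ → ℤ := fun n =>
    match n with
    | 0 => 0
    | i + 1 => d i
  have hu0 : u 0 = 0 := rfl
  have hu : ∀ i, u (i + 1) = d i := fun _ => rfl
  have hu' : ∀ n i, u (n + 1 + i) = d (n + i) := fun n i => by rw [add_right_comm, hu]
  clear_value u
  have hadm : KLAdm u := by
    intro n
    simp only [hu']
    cases n with
    | zero =>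
      simp only [zero_add]
      refine ⟨fun _ h => LexLT.irrefl _ (h.trans hlt), fun _ h => ?_⟩
      have := le_of _ _ h
      rw [klSeq_initial.1, hd0] at this
      omega
    | succ n =>
      rw [hu]
      exact ⟨fun hn h => LexLT.irrefl _ ((h.trans (h1 n hn)).trans hlt),
        fun hn h => LexLT.irrefl _ ((h.trans (h2 n hn)).trans hlt)⟩
  obtain ⟨s, hs0, hs, -⟩ := hadm.exists_jump (fun i => by
    cases i with
    | zero => simp [hu0]
    | succ i => rw [hu]; exact hd i) (by omega) (by rw [hu, hd0])
  have hds : d = jump s := by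
    funext i
    rw [← hu, hs]
  have hs1 : s 1 = true := by
    have := hds ▸ hd0
    simp only [jump, hs0] at this
    revert this
    cases s 1 <;> simp
  refine not_lexLT_thueMorse hs0 hs1 (fun n hn => ?_)
    (LexLT.of_jump (by simp [hs0, thueMorse_initial])
    (hds ▸ hlt))
  obtain ⟨n, rfl⟩ := Nat.exists_eq_add_of_le' hn
  refine LexLT.of_jump (by simp [hs0, normTail]) ?_
  rw [hds] at h1 h2
  cases hsn : s (n + 1) with
  | false =>
    rw [jump_normTail_of_false hsn]
    refine h1 n ?_
    simp only [jump, hsn]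
    cases s n <;> simp
  | true =>
    rw [jump_normTail_of_true hsn]
    refine h2 n ?_
    simp only [jump, hsn]
    cases s n <;> simp

/-! ### Expansions in a non-integer base -/

/-- The number with expansion `t` in base `q`. -/
def val (q : ℝ) (t : ℕ → ℤ) : ℝ := ∑' i, (t i : ℝ) / q ^ (i + 1)

theorem abs_le_one_of_mem {x : ℤ} (h : x ∈ ({-1, 0, 1} : Set ℤ)) : |(x : ℝ)| ≤ 1 := by
  rcases h with rfl | rfl | rfl <;> simp

theorem neg_mem_digits {x : ℤ} (h : x ∈ ({-1, 0, 1} : Set ℤ)) : -x ∈ ({-1, 0, 1} : Set ℤ) := by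
  rcases h with rfl | rfl | rfl <;> simp

theorem hasSum_inv_pow_succ {q : ℝ} (hq : 1 < q) :
    HasSum (fun i : ℕ => 1 / q ^ (i + 1)) (1 / (q - 1)) := by
  have h := (hasSum_geometric_of_lt_one (r := q⁻¹) (by positivity)
    (inv_lt_one_of_one_lt₀ hq)).mul_left q⁻¹
  have hq0 : q ≠ 0 := by positivity
  have hq1 : q - 1 ≠ 0 := by linarith
  have e1 : q⁻¹ * (1 - q⁻¹)⁻¹ = 1 / (q - 1) := by
    have : (1 - q⁻¹) = (q - 1) / q := by field_simp
    rw [this]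
    field_simp
  have e2 : (fun i : ℕ => 1 / q ^ (i + 1)) = fun i => q⁻¹ * q⁻¹ ^ i := by
    funext i
    rw [pow_succ', one_div, mul_inv, inv_pow]
  rw [e2, ← e1]
  exact h

theorem summable_val {q : ℝ} (hq : 1 < q) {t : ℕ → ℤ} (ht : ∀ i, t i ∈ ({-1, 0, 1} : Set ℤ)) :
    Summable (fun i => (t i : ℝ) / q ^ (i + 1)) := by
  refine Summable.of_norm_bounded (hasSum_inv_pow_succ hq).summable fun i => ?_
  rw [Real.norm_eq_abs, abs_div, abs_of_pos (by positivity : 0 < q ^ (i + 1))]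
  have := abs_le_one_of_mem (ht i)
  gcongr

theorem val_neg (q : ℝ) (t : ℕ → ℤ) : val q (fun i => -t i) = -val q t := by
  simp only [val, Int.cast_neg, neg_div, tsum_neg]

theorem val_le {q : ℝ} (hq : 1 < q) {t : ℕ → ℤ} (ht : ∀ i, t i ∈ ({-1, 0, 1} : Set ℤ)) :
    val q t ≤ 1 / (q - 1) := by
  rw [← (hasSum_inv_pow_succ hq).tsum_eq, val]
  refine (summable_val hq ht).tsum_le_tsum (fun i => ?_) (hasSum_inv_pow_succ hq).summable
  have := (abs_le.1 (abs_le_one_of_mem (ht i))).2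
  gcongr

theorem neg_le_val {q : ℝ} (hq : 1 < q) {t : ℕ → ℤ} (ht : ∀ i, t i ∈ ({-1, 0, 1} : Set ℤ)) :
    -(1 / (q - 1)) ≤ val q t := by
  have := val_le hq (t := fun i => -t i) fun i => neg_mem_digits (ht i)
  rw [val_neg] at this
  linarith

theorem neg_lt_val {q : ℝ} (hq : 1 < q) {t : ℕ → ℤ} (ht : ∀ i, t i ∈ ({-1, 0, 1} : Set ℤ))
    {k : ℕ} (hk : -1 < t k) : -(1 / (q - 1)) < val q t := by
  rw [← (hasSum_inv_pow_succ hq).tsum_eq, val, ← tsum_neg]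
  refine Summable.tsum_lt_tsum (i := k) (fun i => ?_) ?_ (hasSum_inv_pow_succ hq).summable.neg
    (summable_val hq ht)
  · have := (abs_le.1 (abs_le_one_of_mem (ht i))).1
    rw [← neg_div]
    gcongr
  · have : (-1 : ℝ) < t k := by exact_mod_cast hk
    rw [← neg_div]
    gcongr

theorem val_tail {q : ℝ} (hq : 1 < q) {t : ℕ → ℤ} (ht : ∀ i, t i ∈ ({-1, 0, 1} : Set ℤ)) (n : ℕ) :
    val q (fun i => t (n + i)) = (t n + val q (fun i => t (n + 1 + i))) / q := by
  have hs := summable_val hq (t := fun i => t (n + i)) fun i => ht _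
  have hq0 : q ≠ 0 := by positivity
  rw [val, hs.tsum_eq_zero_add, val, add_div, ← tsum_div_const]
  congr 1
  · simp
  · refine tsum_congr fun i => ?_
    rw [add_assoc n 1 i, add_comm 1 i, pow_succ q (i + 1)]
    field_simp

theorem val_split {q : ℝ} (hq : 1 < q) {t : ℕ → ℤ} (ht : ∀ i, t i ∈ ({-1, 0, 1} : Set ℤ)) (n : ℕ) :
    val q t = ∑ i ∈ Finset.range n, (t i : ℝ) / q ^ (i + 1) +
      val q (fun i => t (n + i)) / q ^ n := by
  have hq0 : q ≠ 0 := by positivity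
  induction n with
  | zero => simp
  | succ n ih =>
    rw [ih, val_tail hq ht, Finset.sum_range_succ, pow_succ]
    field_simp
    ring

theorem val_sub_of_eq_initial {q : ℝ} (hq : 1 < q) {a b : ℕ → ℤ}
    (ha : ∀ i, a i ∈ ({-1, 0, 1} : Set ℤ)) (hb : ∀ i, b i ∈ ({-1, 0, 1} : Set ℤ)) {k : ℕ}
    (h : ∀ j < k, a j = b j) :
    val q b - val q a = (b k - a k + val q (fun i => b (k + 1 + i)) -
      val q (fun i => a (k + 1 + i))) / q ^ (k + 1) := by
  have hq0 : q ≠ 0 := by positivity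
  rw [val_split hq ha k, val_split hq hb k, val_tail hq ha, val_tail hq hb,
    Finset.sum_congr rfl fun j hj =>
      show (a j : ℝ) / q ^ (j + 1) = (b j : ℝ) / q ^ (j + 1) by rw [h j (Finset.mem_range.1 hj)]]
  rw [pow_succ]
  field_simp
  ring

/-- The tails of `t` following a digit which is not maximal are small. -/
def UpperAdm (q : ℝ) (t : ℕ → ℤ) : Prop :=
  ∀ n, t n < 1 → val q (fun i => t (n + 1 + i)) < 1 - 1 / (q - 1)

theorem UpperAdm.val_lt {q : ℝ} (hq : 1 < q) {a b : ℕ → ℤ}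
    (ha : ∀ i, a i ∈ ({-1, 0, 1} : Set ℤ)) (hb : ∀ i, b i ∈ ({-1, 0, 1} : Set ℤ))
    (h : UpperAdm q a) (hab : LexLT a b) : val q a < val q b := by
  obtain ⟨k, hk, hk'⟩ := hab
  rw [← sub_pos, val_sub_of_eq_initial hq ha hb hk]
  have hb' := hb k
  have ha' := ha k
  simp only [Set.mem_insert_iff, Set.mem_singleton_iff] at ha' hb'
  have h1 := h k (by omega)
  have h2 := neg_le_val hq (t := fun i => b (k + 1 + i)) fun i => hb _
  have h3 : (a k : ℝ) + 1 ≤ b k := by exact_mod_cast hk'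
  apply div_pos _ (by positivity)
  linarith

theorem exists_val_eq {q : ℝ} (hq : 1 < q) (hq3 : q ≤ 3) {x : ℝ} (hx : |x| ≤ 1 / (q - 1)) :
    ∃ t : ℕ → ℤ, (∀ i, t i ∈ ({-1, 0, 1} : Set ℤ)) ∧ val q t = x := by
  have hq1 : 0 < q - 1 := by linarith
  have hstep : ∀ y : ℝ, |y| ≤ 1 / (q - 1) →
      ∃ d : ℤ, d ∈ ({-1, 0, 1} : Set ℤ) ∧ |q * y - d| ≤ 1 / (q - 1) := by
    intro y hy
    have hhalf : 1 / 2 ≤ 1 / (q - 1) := by gcongr; linarith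
    have hy' := abs_le.1 hy
    have h1 : q * y ≤ 1 + 1 / (q - 1) := by
      have : q * y ≤ q * (1 / (q - 1)) := by gcongr; exact hy'.2
      have e : q * (1 / (q - 1)) = 1 + 1 / (q - 1) := by field_simp; ring
      linarith
    have h2 : -(1 + 1 / (q - 1)) ≤ q * y := by
      have : q * (-(1 / (q - 1))) ≤ q * y := by gcongr; exact hy'.1
      have e : q * (-(1 / (q - 1))) = -(1 + 1 / (q - 1)) := by field_simp; ring
      linarith
    rcases lt_or_ge (q * y) (-(1 / 2)) with h | h
    · refine ⟨-1, by simp, ?_⟩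
      push_cast
      rw [abs_le]
      constructor <;> linarith
    · rcases lt_or_ge (1 / 2) (q * y) with h' | h'
      · refine ⟨1, by simp, ?_⟩
        push_cast
        rw [abs_le]
        constructor <;> linarith
      · refine ⟨0, by simp, ?_⟩
        push_cast
        rw [abs_le]
        constructor <;> linarith
  choose! D hD hD' using hstep
  let orbit : ℕ → ℝ := fun n => Nat.rec x (fun _ y => q * y - D y) n
  have o0 : orbit 0 = x := rfl
  have os : ∀ n, orbit (n + 1) = q * orbit n - D (orbit n) := fun _ => rfl
  clear_value orbit
  have hbd : ∀ n, |orbit n| ≤ 1 / (q - 1) := by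
    intro n
    induction n with
    | zero => rwa [o0]
    | succ n ih => rw [os]; exact hD' _ ih
  have hdig : ∀ i, D (orbit i) ∈ ({-1, 0, 1} : Set ℤ) := fun i => hD _ (hbd i)
  refine ⟨fun i => D (orbit i), hdig, ?_⟩
  have hpart : ∀ n, ∑ i ∈ Finset.range n, (D (orbit i) : ℝ) / q ^ (i + 1) =
      x - orbit n * (q⁻¹) ^ n := by
    intro n
    induction n with
    | zero => simp [o0]
    | succ n ih =>
      rw [Finset.sum_range_succ, ih, os, inv_pow, inv_pow]
      have : q ≠ 0 := by positivity
      field_simp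
      ring
  have hlim : Tendsto (fun n => x - orbit n * (q⁻¹) ^ n) atTop (nhds (x - 0)) := by
    refine tendsto_const_nhds.sub ?_
    have hg := tendsto_pow_atTop_nhds_zero_of_lt_one (r := q⁻¹) (by positivity)
      (inv_lt_one_of_one_lt₀ hq)
    refine squeeze_zero_norm (a := fun n => 1 / (q - 1) * q⁻¹ ^ n) (fun n => ?_)
      (by simpa using hg.const_mul (1 / (q - 1)))
    rw [norm_mul, Real.norm_eq_abs, Real.norm_eq_abs, abs_of_nonneg (a := q⁻¹ ^ n) (by positivity)]
    have := hbd n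
    gcongr
  rw [sub_zero] at hlim
  refine tendsto_nhds_unique (summable_val hq hdig).hasSum.tendsto_sum_nat ?_
  simpa only [hpart] using hlim

theorem uniqSeqSet.upperAdm {q : ℝ} (hq : 1 < q) (hq3 : q ≤ 3) {t : ℕ → ℤ}
    (ht : t ∈ uniqSeqSet q) : UpperAdm q t := by
  intro n hn
  by_contra! hge
  have hle := val_le hq (t := fun i => t (n + 1 + i)) fun i => ht.1 _
  obtain ⟨w, hw, hwv⟩ := exists_val_eq hq hq3
    (x := val q (fun i => t (n + 1 + i)) - 1) (abs_le.2 ⟨by linarith, by linarith⟩)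
  let s : ℕ → ℤ := fun i => if i < n then t i else if i = n then t n + 1 else w (i - (n + 1))
  have hs : ∀ i, s i ∈ ({-1, 0, 1} : Set ℤ) := by
    intro i
    simp only [s]
    split_ifs
    · exact ht.1 i
    · have := ht.1 n
      simp only [Set.mem_insert_iff, Set.mem_singleton_iff] at this ⊢
      omega
    · exact hw _
  have hsn : s n = t n + 1 := by simp [s]
  have hsw : (fun i => s (n + 1 + i)) = w := by
    funext i
    have h1 : ¬ n + 1 + i < n := by omega
    have h2 : ¬ n + 1 + i = n := by omega
    simp [s, h1, h2]
  have hval : val q t - val q s = 0 := by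
    rw [val_sub_of_eq_initial hq hs ht.1 (k := n) fun j hj => by simp [s, hj], hsw, hwv, hsn]
    push_cast
    ring
  have := congrFun (ht.2 s hs (by have := sub_eq_zero.1 hval; exact this.symm)) n
  omega

theorem uniqSeqSet.neg {q : ℝ} {t : ℕ → ℤ} (ht : t ∈ uniqSeqSet q) :
    (fun i => -t i) ∈ uniqSeqSet q := by
  refine ⟨fun i => neg_mem_digits (ht.1 i), fun s hs h => ?_⟩
  have := ht.2 (fun i => -s i) (fun i => neg_mem_digits (hs i)) (by
    change val q _ = val q _
    rw [val_neg, show val q s = _ from h]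
    exact (congrArg Neg.neg (val_neg q t)).trans (neg_neg _))
  funext i
  rw [← this, neg_neg]

theorem mem_uniqSeqSet_of_upperAdm {q : ℝ} (hq : 1 < q) {t : ℕ → ℤ}
    (ht : ∀ i, t i ∈ ({-1, 0, 1} : Set ℤ)) (h : UpperAdm q t)
    (h' : UpperAdm q (fun i => -t i)) : t ∈ uniqSeqSet q := by
  refine ⟨ht, fun s hs hst => ?_⟩
  change val q s = val q t at hst
  rcases lexLT_trichotomy s t with hlt | hlt | ⟨k, hk, hk'⟩
  · obtain ⟨k, hk, hk'⟩ := hlt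
    have := h'.val_lt hq (fun i => neg_mem_digits (ht i)) (b := fun i => -s i)
      (fun i => neg_mem_digits (hs i)) ⟨k, fun j hj => by simp [hk j hj], by simpa using hk'⟩
    rw [val_neg, val_neg, hst] at this
    exact absurd this (lt_irrefl _)
  · exact hlt
  · have := h.val_lt hq ht hs ⟨k, hk, hk'⟩
    rw [hst] at this
    exact absurd this (lt_irrefl _)

/-! ### The Komornik–Loreti constant -/

theorem klSeq_mem (i : ℕ) : klSeq i ∈ ({-1, 0, 1} : Set ℤ) := jump_mem _ _

theorem exists_klSeq_nonneg (n : ℕ) : ∃ i, -1 < klSeq (n + i) := by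
  by_contra! hc
  have h0 := hc 0
  have h1 := hc 1
  revert h0 h1
  simp only [klSeq, jump, add_zero]
  cases thueMorse n <;> cases thueMorse (n + 1) <;> cases thueMorse (n + 1 + 1) <;> simp

theorem val_lt_of_lexLT_klSeq {p : ℝ} (hp : 1 < p) (hval : val p klSeq = 1 - 1 / (p - 1))
    {t : ℕ → ℤ} (ht : ∀ i, t i ∈ ({-1, 0, 1} : Set ℤ))
    (h : ∀ n, LexLT (fun i => t (n + 1 + i)) klSeq) (n : ℕ) :
    val p (fun i => t (n + 1 + i)) < 1 - 1 / (p - 1) := by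
  have hp0 : 0 < p := by linarith
  set e : ℕ → ℝ := fun n => val p (fun i => t (n + 1 + i)) - (1 - 1 / (p - 1)) with he
  have hstep : ∀ n, ∃ k : ℕ, e n < e (n + 1 + k) / p ^ (k + 1) := by
    intro n
    obtain ⟨k, hk, hk'⟩ := h n
    refine ⟨k, ?_⟩
    have hsub := val_sub_of_eq_initial hp (a := fun i => t (n + 1 + i)) (b := klSeq)
      (fun i => ht _) klSeq_mem hk
    obtain ⟨j, hj⟩ := exists_klSeq_nonneg (k + 1)
    have hlow := neg_lt_val hp (t := fun i => klSeq (k + 1 + i)) (fun i => klSeq_mem _) hj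
    have hd : (t (n + 1 + k) : ℝ) + 1 ≤ klSeq k := by exact_mod_cast hk'
    rw [hval] at hsub
    have hen : e n = -((klSeq k - t (n + 1 + k) + val p (fun i => klSeq (k + 1 + i)) -
      val p (fun i => t (n + 1 + (k + 1 + i)))) / p ^ (k + 1)) := by
      rw [← hsub]
      simp only [he]
      ring
    have ek : e (n + 1 + k) = val p (fun i => t (n + 1 + (k + 1 + i))) - (1 - 1 / (p - 1)) := by
      simp only [he, add_assoc]
    rw [hen, ek, ← neg_div]
    gcongr
    linarith
  have hbd : ∀ m n : ℕ, e n ≤ (2 / (p - 1)) / p ^ m := by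
    intro m
    induction m with
    | zero =>
      intro n
      have := val_le hp (t := fun i => t (n + 1 + i)) fun i => ht _
      simp only [he, pow_zero, div_one]
      have : 2 / (p - 1) = 1 / (p - 1) + 1 / (p - 1) := by ring
      linarith
    | succ m ih =>
      intro n
      obtain ⟨k, hk⟩ := hstep n
      have hp1 : 0 < p - 1 := by linarith
      calc e n ≤ e (n + 1 + k) / p ^ (k + 1) := hk.le
        _ ≤ ((2 / (p - 1)) / p ^ m) / p ^ (k + 1) := by gcongr; exact ih _
        _ ≤ ((2 / (p - 1)) / p ^ m) / p ^ 1 := by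
          gcongr
          · exact hp.le
          · omega
        _ = (2 / (p - 1)) / p ^ (m + 1) := by rw [div_div, ← pow_add]
  have hnonpos : ∀ n, e n ≤ 0 := by
    intro n
    have hlim : Tendsto (fun m : ℕ => (2 / (p - 1)) / p ^ m) atTop (nhds 0) :=
      tendsto_const_nhds.div_atTop (tendsto_pow_atTop_atTop_of_one_lt hp)
    exact ge_of_tendsto' hlim fun m => hbd m n
  obtain ⟨k, hk⟩ := hstep n
  have h0 : e (n + 1 + k) / p ^ (k + 1) ≤ 0 :=
    div_nonpos_of_nonpos_of_nonneg (hnonpos _) (by positivity)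
  have : e n < 0 := hk.trans_le h0
  simp only [he] at this
  linarith

theorem StrictKLAdm.mem_uniqSeqSet {p : ℝ} (hp : 1 < p) (hval : val p klSeq = 1 - 1 / (p - 1))
    {t : ℕ → ℤ} (ht : ∀ i, t i ∈ ({-1, 0, 1} : Set ℤ)) (h : StrictKLAdm t) :
    t ∈ uniqSeqSet p :=
  mem_uniqSeqSet_of_upperAdm hp ht
    (fun n _ => val_lt_of_lexLT_klSeq hp hval ht (fun n => (h n).1) n)
    (fun n _ => val_lt_of_lexLT_klSeq hp hval (fun i => neg_mem_digits (ht i))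
      (fun n => (h n).2) n)

theorem klAdm_of_mem_uniqSeqSet {p : ℝ} (hp : 1 < p) (hp3 : p ≤ 3)
    (hval : val p klSeq = 1 - 1 / (p - 1)) {t : ℕ → ℤ} (ht : t ∈ uniqSeqSet p) : KLAdm t := by
  have hkl := uniqSeqSet.upperAdm hp hp3 (strictKLAdm_klSeq.mem_uniqSeqSet hp hval klSeq_mem)
  intro n
  refine ⟨fun hn hlt => ?_, fun hn hlt => ?_⟩
  · have h1 := hkl.val_lt hp klSeq_mem (fun i => ht.1 _) hlt
    have h2 := uniqSeqSet.upperAdm hp hp3 ht n hn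
    linarith
  · have h1 := hkl.val_lt hp klSeq_mem (fun i => neg_mem_digits (ht.1 _)) hlt
    have h2 := uniqSeqSet.upperAdm hp hp3 (uniqSeqSet.neg ht) n (by omega)
    linarith

theorem tsum_add_one {p : ℝ} (hp : 1 < p) {t : ℕ → ℤ} (ht : ∀ i, t i ∈ ({-1, 0, 1} : Set ℤ)) :
    ∑' i, ((t i : ℝ) + 1) / p ^ (i + 1) = val p t + 1 / (p - 1) := by
  simp only [add_div]
  rw [(summable_val hp ht).tsum_add (hasSum_inv_pow_succ hp).summable,
    (hasSum_inv_pow_succ hp).tsum_eq, val]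

theorem uniqueOneExp_iff {p : ℝ} (hp : 1 < p) :
    uniqueOneExp p ↔ ∃ d ∈ uniqSeqSet p, val p d = 1 - 1 / (p - 1) := by
  constructor
  · rintro ⟨c, ⟨hc, hc1⟩, huniq⟩
    have hd : ∀ i, (c i : ℤ) - 1 ∈ ({-1, 0, 1} : Set ℤ) := fun i => by
      have := hc i
      simp only [Set.mem_insert_iff, Set.mem_singleton_iff]
      omega
    have hval : val p (fun i => (c i : ℤ) - 1) = 1 - 1 / (p - 1) := by
      have := tsum_add_one hp hd
      simp only [Int.cast_sub, Int.cast_natCast, Int.cast_one, sub_add_cancel] at this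
      rw [← hc1] at this
      linarith
    refine ⟨_, ⟨hd, fun s hs hsv => ?_⟩, hval⟩
    have hs1 : ∀ i, s i = -1 ∨ s i = 0 ∨ s i = 1 := fun i => by simpa using hs i
    have hcast : ∀ i, (((s i + 1).toNat : ℕ) : ℝ) = (s i : ℝ) + 1 := fun i => by
      have : (((s i + 1).toNat : ℕ) : ℤ) = s i + 1 := Int.toNat_of_nonneg (by
        have := hs1 i
        omega)
      exact_mod_cast congrArg (Int.cast : ℤ → ℝ) this
    have := huniq (fun i => (s i + 1).toNat) ⟨fun i => by have := hs1 i; simp only; omega, by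
      simp only [hcast]
      rw [tsum_add_one hp hs, show val p s = _ from hsv.trans hval]
      ring⟩
    funext i
    have h1 := congrFun this i
    have h2 := hs1 i
    omega
  · rintro ⟨d, hd, hval⟩
    have hd1 : ∀ i, d i = -1 ∨ d i = 0 ∨ d i = 1 := fun i => by simpa using hd.1 i
    have hcast : ∀ i, (((d i + 1).toNat : ℕ) : ℝ) = (d i : ℝ) + 1 := fun i => by
      have : (((d i + 1).toNat : ℕ) : ℤ) = d i + 1 := Int.toNat_of_nonneg (by
        have := hd1 i
        omega)
      exact_mod_cast congrArg (Int.cast : ℤ → ℝ) this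
    refine ⟨fun i => (d i + 1).toNat, ⟨fun i => by have := hd1 i; simp only; omega, ?_⟩, ?_⟩
    · simp only [hcast]
      rw [tsum_add_one hp hd.1, hval]
      ring
    · rintro c ⟨hc, hc1⟩
      have hc' : ∀ i, (c i : ℤ) - 1 ∈ ({-1, 0, 1} : Set ℤ) := fun i => by
        have := hc i
        simp only [Set.mem_insert_iff, Set.mem_singleton_iff]
        omega
      have hcv : val p (fun i => (c i : ℤ) - 1) = val p d := by
        have := tsum_add_one hp hc'
        simp only [Int.cast_sub, Int.cast_natCast, Int.cast_one, sub_add_cancel] at this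
        rw [← hc1] at this
        rw [hval]
        linarith
      have := hd.2 _ hc' hcv
      funext i
      have h1 := congrFun this i
      have h2 := hd1 i
      omega

theorem exists_base_val_klSeq :
    ∃ p : ℝ, 2 < p ∧ p ≤ 3 ∧ val p klSeq = 1 - 1 / (p - 1) := by
  have hcont : ContinuousOn (fun p : ℝ => val p klSeq + 1 / (p - 1)) (Set.Icc 2 3) := by
    refine ContinuousOn.add ?_ ?_
    · refine continuousOn_tsum (u := fun i => 1 / (2 : ℝ) ^ (i + 1)) (fun i => ?_)
        (hasSum_inv_pow_succ (by norm_num)).summable fun i p hp => ?_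
      · refine continuousOn_const.div (by fun_prop) fun p hp => ?_
        have := hp.1
        positivity
      · have h2 := hp.1
        rw [Real.norm_eq_abs, abs_div, abs_of_pos (a := p ^ (i + 1)) (by positivity)]
        have := abs_le_one_of_mem (klSeq_mem i)
        gcongr
    · refine continuousOn_const.div (by fun_prop) fun p hp => ?_
      have := hp.1
      linarith
  have h3 : val 3 klSeq + 1 / (3 - 1) ≤ 1 := by
    have := val_le (q := 3) (by norm_num) klSeq_mem
    norm_num at this ⊢
    linarith
  have h2 : 1 < val 2 klSeq + 1 / (2 - 1) := by
    obtain ⟨l0, l1, l2⟩ := klSeq_initial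
    have hs := val_split (q := 2) (by norm_num) klSeq_mem 3
    have := neg_le_val (q := 2) (by norm_num) (t := fun i => klSeq (3 + i)) fun i => klSeq_mem _
    simp only [Finset.sum_range_succ, Finset.sum_range_zero, l0, l1, l2] at hs
    norm_num at this hs ⊢
    rw [hs]
    linarith
  obtain ⟨p, hp, hpv⟩ := intermediate_value_Icc' (by norm_num : (2 : ℝ) ≤ 3) hcont
    (show (1 : ℝ) ∈ Set.Icc _ _ from ⟨h3, h2.le⟩)
  simp only at hpv
  refine ⟨p, lt_of_le_of_ne hp.1 ?_, hp.2, by linarith⟩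
  rintro rfl
  linarith

theorem base_eq_komornikLoreti {q : ℝ} (hq1 : 1 < q) (hq2 : uniqueOneExp q)
    (hq3 : ∀ p, 1 < p → uniqueOneExp p → q ≤ p) :
    2 < q ∧ q ≤ 3 ∧ val q klSeq = 1 - 1 / (q - 1) := by
  obtain ⟨p, hp2, hp3, hp⟩ := exists_base_val_klSeq
  have hp1 : 1 < p := by linarith
  have hklp := strictKLAdm_klSeq.mem_uniqSeqSet hp1 hp klSeq_mem
  have hqp : q ≤ p := hq3 p hp1 ((uniqueOneExp_iff hp1).2 ⟨_, hklp, hp⟩)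
  rcases hqp.eq_or_lt with rfl | hlt
  · exact ⟨hp2, hp3, hp⟩
  exfalso
  obtain ⟨d, hd, hdv⟩ := (uniqueOneExp_iff hq1).1 hq2
  have hup := uniqSeqSet.upperAdm hq1 (hqp.trans hp3) hd
  have hup' := uniqSeqSet.upperAdm hq1 (hqp.trans hp3) (uniqSeqSet.neg hd)
  have hlex : ∀ w : ℕ → ℤ, (∀ i, w i ∈ ({-1, 0, 1} : Set ℤ)) → val q w < 1 - 1 / (q - 1) →
      LexLT w d := by
    intro w hw hwv
    rcases lexLT_trichotomy w d with h | h | h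
    · exact h
    · rw [h] at hwv
      linarith
    · have := hup.val_lt hq1 hd.1 hw h
      linarith
  have hnot := not_lexLT_klSeq hd.1 (fun n hn => hlex _ (fun i => hd.1 _) (hup n hn))
    (fun n hn => hlex _ (fun i => neg_mem_digits (hd.1 _)) (hup' n (by simp only; omega)))
  have hle : val p klSeq ≤ val p d := by
    rcases lexLT_trichotomy klSeq d with h | h | h
    · exact ((uniqSeqSet.upperAdm hp1 hp3 hklp).val_lt hp1 klSeq_mem hd.1 h).le
    · rw [h]
    · exact absurd h hnot
  have hone : val q d + 1 / (q - 1) = 1 := by linarith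
  have hpos : ∀ i, (0 : ℝ) ≤ (d i : ℝ) + 1 := fun i => by
    have := (abs_le.1 (abs_le_one_of_mem (hd.1 i))).1
    linarith
  have hexists : ∃ i, (0 : ℝ) < (d i : ℝ) + 1 := by
    by_contra! hc
    have hz : ∀ i, (d i : ℝ) + 1 = 0 := fun i => le_antisymm (hc i) (hpos i)
    rw [← tsum_add_one hq1 hd.1] at hone
    simp [hz] at hone
  obtain ⟨k, hk⟩ := hexists
  have hs : ∀ {r : ℝ}, 1 < r → Summable fun i => ((d i : ℝ) + 1) / r ^ (i + 1) := fun hr => by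
    simp only [add_div]
    exact (summable_val hr hd.1).add (hasSum_inv_pow_succ hr).summable
  have hltsum : val p d + 1 / (p - 1) < val q d + 1 / (q - 1) := by
    rw [← tsum_add_one hq1 hd.1, ← tsum_add_one hp1 hd.1]
    refine Summable.tsum_lt_tsum (i := k) (fun i => ?_) ?_ (hs hp1) (hs hq1)
    · have := hpos i
      gcongr
    · gcongr
  linarith

/-! ### The dimension of sets coded by sequences with prescribed digits -/

/-- The sequences which agree with `e` outside `p`. -/
def freeOn (p : ℕ → Prop) (e : ℕ → Fin 3) : Set (ℕ → Fin 3) := {w | ∀ i, ¬ p i → w i = e i}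

theorem dimH_image_freeOn_le {X : Type*} [MetricSpace X] {q C : ℝ} (hq : 1 < q) (hC : 0 ≤ C)
    {f : (ℕ → Fin 3) → X}
    (hf : ∀ w w' m, (∀ i < m, w i = w' i) → dist (f w) (f w') ≤ C * (q ^ m)⁻¹)
    {p : ℕ → Prop} [DecidablePred p] (e : ℕ → Fin 3) {d : ℝ}
    (hp : CloseDens p d 0) :
    dimH (f '' freeOn p e) ≤ ENNReal.ofReal (d * (Real.log 3 / Real.log q)) := by
  borelize X
  have hlog3 : 0 < Real.log 3 := Real.log_pos (by norm_num)
  have hlogq : 0 < Real.log q := Real.log_pos hq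
  have hq0 : 0 < q := by linarith
  refine ENNReal.le_of_forall_pos_le_add fun ε hε _ => ?_
  set r : NNReal := Real.toNNReal (d * (Real.log 3 / Real.log q)) + ε with hr
  have hrgt : d * (Real.log 3 / Real.log q) < r := by
    rw [hr, NNReal.coe_add]
    have h1 := Real.le_coe_toNNReal (d * (Real.log 3 / Real.log q))
    have h2 : (0 : ℝ) < ε := hε
    linarith
  have hgoal : ENNReal.ofReal (d * (Real.log 3 / Real.log q)) + ε = r := by
    rw [hr, ENNReal.coe_add, ENNReal.ofReal]
  rw [hgoal]
  apply dimH_le_of_hausdorffMeasure_ne_top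
  set δ : ℝ := r * Real.log q / Real.log 3 - d with hδ
  have hδ0 : 0 < δ := by
    rw [hδ, sub_pos, lt_div_iff₀ hlog3]
    rw [← mul_div_assoc, div_lt_iff₀ hlogq] at hrgt
    exact hrgt
  have hcount := hp δ hδ0
  have hpow : ∀ᶠ m : ℕ in atTop, (3 : ℝ) ^ Nat.count p m * (C * (q ^ m)⁻¹) ^ (r : ℝ) ≤
      C ^ (r : ℝ) := by
    filter_upwards [hcount] with m hm
    have hle : (Nat.count p m : ℝ) ≤ r * Real.log q / Real.log 3 * m := by
      have := (abs_le.1 hm).2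
      rw [hδ] at this
      linarith
    have h3 : (3 : ℝ) ^ Nat.count p m ≤ (q ^ m) ^ (r : ℝ) := by
      rw [← Real.log_le_log_iff (by positivity) (by positivity), Real.log_pow,
        Real.log_rpow (by positivity), Real.log_pow]
      calc (Nat.count p m : ℝ) * Real.log 3
          ≤ r * Real.log q / Real.log 3 * m * Real.log 3 := by gcongr
        _ = r * (m * Real.log q) := by field_simp
    rw [Real.mul_rpow hC (by positivity), Real.inv_rpow (by positivity)]
    have hpos : 0 < (q ^ m) ^ (r : ℝ) := by positivity
    calc (3 : ℝ) ^ Nat.count p m * (C ^ (r : ℝ) * ((q ^ m) ^ (r : ℝ))⁻¹)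
        ≤ (q ^ m) ^ (r : ℝ) * (C ^ (r : ℝ) * ((q ^ m) ^ (r : ℝ))⁻¹) := by gcongr
      _ = C ^ (r : ℝ) := by field_simp
  let t : ∀ m : ℕ, ({i // i ∈ (Finset.range m).filter p} → Fin 3) → Set X := fun m g =>
    f '' {w | ∀ i < m, w i = if h : i ∈ (Finset.range m).filter p then g ⟨i, h⟩ else e i}
  have hdiam : ∀ m g, Metric.ediam (t m g) ≤ ENNReal.ofReal (C * (q ^ m)⁻¹) := by
    intro m g
    apply Metric.ediam_le
    rintro _ ⟨w, hw, rfl⟩ _ ⟨w', hw', rfl⟩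
    rw [edist_dist]
    exact ENNReal.ofReal_le_ofReal (hf _ _ _ fun i hi => (hw i hi).trans (hw' i hi).symm)
  have hcover : ∀ m, f '' freeOn p e ⊆ ⋃ g, t m g := by
    rintro m _ ⟨w, hw, rfl⟩
    refine Set.mem_iUnion.2 ⟨fun i => w i, w, fun i hi => ?_, rfl⟩
    split_ifs with h
    · rfl
    · refine hw i fun hpi => h ?_
      simp [hi, hpi]
  have hlim : Tendsto (fun m : ℕ => ENNReal.ofReal (C * (q ^ m)⁻¹)) atTop (nhds 0) := by
    have h1 : Tendsto (fun m : ℕ => C * (q ^ m)⁻¹) atTop (nhds (C * 0)) :=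
      (tendsto_pow_atTop_atTop_of_one_lt hq).inv_tendsto_atTop.const_mul C
    rw [mul_zero] at h1
    simpa using ENNReal.tendsto_ofReal h1
  have hmeas := MeasureTheory.Measure.hausdorffMeasure_le_liminf_sum (r : ℝ) (f '' freeOn p e) _
    hlim t (Eventually.of_forall hdiam) (Eventually.of_forall hcover)
  refine ne_top_of_le_ne_top (ENNReal.ofReal_ne_top (r := C ^ (r : ℝ))) (hmeas.trans ?_)
  refine le_trans (liminf_le_liminf (v := fun _ => ENNReal.ofReal (C ^ (r : ℝ))) ?_)
    (liminf_const _).le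
  filter_upwards [hpow] with m hm
  calc ∑ g, Metric.ediam (t m g) ^ (r : ℝ)
      ≤ ∑ _g : {i // i ∈ (Finset.range m).filter p} → Fin 3,
          ENNReal.ofReal (C * (q ^ m)⁻¹) ^ (r : ℝ) := by
        refine Finset.sum_le_sum fun g _ => ?_
        exact ENNReal.rpow_le_rpow (hdiam m g) r.coe_nonneg
    _ = ENNReal.ofReal ((3 : ℝ) ^ Nat.count p m * (C * (q ^ m)⁻¹) ^ (r : ℝ)) := by
        rw [Finset.sum_const, Finset.card_univ, Fintype.card_fun, Fintype.card_fin,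
          Fintype.card_coe, ← Nat.count_eq_card_filter_range,
          ENNReal.ofReal_rpow_of_nonneg (by positivity) r.coe_nonneg, nsmul_eq_mul,
          ENNReal.ofReal_mul (by positivity)]
        congr 1
        rw [ENNReal.ofReal_pow (by norm_num)]
        norm_num
    _ ≤ ENNReal.ofReal (C ^ (r : ℝ)) := ENNReal.ofReal_le_ofReal hm

theorem le_dimH_image_freeOn {X : Type*} [MetricSpace X] {q c : ℝ} (hq : 1 < q) (hc : 0 < c)
    {f : (ℕ → Fin 3) → X}
    (hf : ∀ w w' m, (∀ i < m, w i = w' i) → w m ≠ w' m → c * (q ^ m)⁻¹ ≤ dist (f w) (f w'))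
    {p : ℕ → Prop} [DecidablePred p] (e : ℕ → Fin 3) {d : ℝ} (hp : CloseDens p d 0) :
    ENNReal.ofReal (d * (Real.log 3 / Real.log q)) ≤ dimH (f '' freeOn p e) := by
  classical
  have hlog3 : 0 < Real.log 3 := Real.log_pos (by norm_num)
  have hlogq : 0 < Real.log q := Real.log_pos hq
  have hq0 : 0 < q := by linarith
  have hfirst : ∀ w w' : ℕ → Fin 3, w ≠ w' → ∃ m, (∀ i < m, w i = w' i) ∧ w m ≠ w' m := by
    intro w w' hne
    have hex : ∃ m, w m ≠ w' m := Function.ne_iff.1 hne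
    exact ⟨Nat.find hex, fun i hi => not_not.1 (Nat.find_min hex hi), Nat.find_spec hex⟩
  have hinj : Function.Injective f := by
    intro w w' hww
    by_contra hne
    obtain ⟨m, hm, hm'⟩ := hfirst w w' hne
    have := hf w w' m hm hm'
    rw [hww, dist_self] at this
    have : 0 < c * (q ^ m)⁻¹ := by positivity
    linarith
  refine ENNReal.le_of_forall_nnreal_lt fun r hr => ?_
  rcases eq_or_ne r 0 with rfl | hr0
  · simp
  have hr0' : 0 < r := pos_iff_ne_zero.2 hr0
  have hr0r : (0 : ℝ) < r := hr0'
  have hrlt : (r : ℝ) < d * (Real.log 3 / Real.log q) := by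
    rw [ENNReal.ofReal, ENNReal.coe_lt_coe] at hr
    exact (Real.lt_toNNReal_iff_coe_lt).1 hr
  set κ : ℝ := r * Real.log q / Real.log 3 with hκ
  have hκ0 : 0 < κ := by positivity
  have hκd : 0 < d - κ := by
    rw [sub_pos, hκ, div_lt_iff₀ hlog3]
    rw [← mul_div_assoc, lt_div_iff₀ hlogq] at hrlt
    exact hrlt
  obtain ⟨M, hM⟩ := eventually_atTop.1 (hp (d - κ) hκd)
  have hcount : ∀ m ≥ M, κ * m ≤ Nat.count p m := by
    intro m hm
    have := (abs_le.1 (hM m hm)).1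
    linarith
  have hinf : {i | p i}.Infinite := by
    intro hfin
    obtain ⟨N, hN⟩ := eventually_atTop.1 (eventually_const_le_mul hκ0 (hfin.toFinset.card + 1))
    have h1 := hN _ (le_max_right M N)
    have h2 := hcount _ (le_max_left M N)
    have h3 : Nat.count p (max M N) ≤ hfin.toFinset.card := by
      rw [Nat.count_eq_card_filter_range]
      refine Finset.card_le_card fun i hi => ?_
      simpa using (Finset.mem_filter.1 hi).2
    have h4 : (Nat.count p (max M N) : ℝ) ≤ hfin.toFinset.card := by exact_mod_cast h3
    linarith
  let β : (ℕ → Fin 3) → ℝ := fun w => Real.ofDigits fun j => w (Nat.nth p j)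
  have hβ : ∀ w w' m, (∀ i < m, w i = w' i) → |β w - β w'| ≤ ((3 : ℝ) ^ Nat.count p m)⁻¹ := by
    intro w w' m hm
    have := Real.abs_ofDigits_sub_ofDigits_le (b := 3) (x := fun j => w (Nat.nth p j))
      (y := fun j => w' (Nat.nth p j)) (n := Nat.count p m)
      fun j hj => hm _ (Nat.nth_lt_of_lt_count hj)
    exact_mod_cast this
  set K : ℝ := (q ^ M) ^ (r : ℝ) with hK
  have hK0 : 0 < K := by positivity
  have hdecay : ∀ m, ((3 : ℝ) ^ Nat.count p m)⁻¹ ≤ K * ((q ^ m)⁻¹) ^ (r : ℝ) := by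
    intro m
    rw [Real.inv_rpow (by positivity), ← div_eq_mul_inv, inv_le_comm₀ (by positivity)
      (by positivity), inv_div]
    rcases le_or_gt M m with hm | hm
    · have h3 : (q ^ m) ^ (r : ℝ) ≤ (3 : ℝ) ^ Nat.count p m := by
        rw [← Real.log_le_log_iff (by positivity) (by positivity), Real.log_pow,
          Real.log_rpow (by positivity), Real.log_pow]
        calc r * (m * Real.log q) = κ * m * Real.log 3 := by rw [hκ]; field_simp
          _ ≤ _ := by gcongr; exact hcount m hm
      have hK1 : 1 ≤ K := Real.one_le_rpow (one_le_pow₀ hq.le) r.coe_nonneg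
      exact (div_le_self (by positivity) hK1).trans h3
    · have h1 : (q ^ m) ^ (r : ℝ) ≤ K :=
        Real.rpow_le_rpow (by positivity) (pow_le_pow_right₀ hq.le hm.le) r.coe_nonneg
      exact ((div_le_one hK0).2 h1).trans (one_le_pow₀ (by norm_num))
  let φ : X → ℝ := fun x => β (Function.invFun f x)
  have hφ : ∀ w, φ (f w) = β w := fun w => by
    simp only [φ, Function.leftInverse_invFun hinj w]
  have hbound : ∀ w w', |β w - β w'| ≤ K * (c⁻¹) ^ (r : ℝ) * dist (f w) (f w') ^ (r : ℝ) := by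
    intro w w'
    rcases eq_or_ne w w' with rfl | hne
    · rw [sub_self, abs_zero]
      positivity
    · obtain ⟨m, hm, hm'⟩ := hfirst w w' hne
      refine ((hβ w w' m hm).trans (hdecay m)).trans ?_
      rw [mul_assoc, ← Real.mul_rpow (by positivity) dist_nonneg]
      have := hf w w' m hm hm'
      gcongr
      rw [← div_eq_inv_mul, le_div_iff₀ hc, mul_comm]
      exact this
  have hholder : HolderOnWith (Real.toNNReal (K * (c⁻¹) ^ (r : ℝ))) r φ (f '' freeOn p e) := by
    rintro _ ⟨w, -, rfl⟩ _ ⟨w', -, rfl⟩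
    rw [hφ, hφ, edist_dist, edist_dist, ENNReal.ofReal_rpow_of_nonneg dist_nonneg r.coe_nonneg,
      ← ENNReal.ofReal, ← ENNReal.ofReal_mul (by positivity), Real.dist_eq]
    exact ENNReal.ofReal_le_ofReal (hbound w w')
  have himage : Set.Icc (0 : ℝ) 1 ⊆ φ '' (f '' freeOn p e) := by
    intro y hy
    obtain ⟨v, -, hv⟩ := Real.ofDigits_SurjOn (b := 3) (by norm_num) hy
    refine ⟨_, ⟨fun i => if p i then v (Nat.count p i) else e i, fun i hi => by simp [hi], rfl⟩, ?_⟩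
    rw [hφ, ← hv]
    simp only [β]
    congr 1
    funext j
    rw [if_pos (Nat.nth_mem_of_infinite hinf j), Nat.count_nth_of_infinite hinf]
  have hone : dimH (Set.Icc (0 : ℝ) 1) = 1 := by
    rw [Real.dimH_of_nonempty_interior (by simp)]
    simp
  have h1 := (hone.symm.le.trans (dimH_mono himage)).trans (hholder.dimH_image_le hr0')
  rwa [ENNReal.le_div_iff_mul_le (Or.inl (by exact_mod_cast hr0)) (Or.inl ENNReal.coe_ne_top),
    one_mul] at h1

/-! ### Codings of the gasket -/

/-- The three digits of the gasket. -/
def corner : Fin 3 → ℤ × ℤ := ![(0, 0), (0, 1), (1, 0)]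

theorem corner_mem (j : Fin 3) :
    (corner j).1 ∈ ({-1, 0, 1} : Set ℤ) ∧ (corner j).2 ∈ ({-1, 0, 1} : Set ℤ) := by
  fin_cases j <;> simp [corner]

theorem corner_sub_mem (j k : Fin 3) :
    (corner j).1 - (corner k).1 ∈ ({-1, 0, 1} : Set ℤ) ∧
      (corner j).2 - (corner k).2 ∈ ({-1, 0, 1} : Set ℤ) := by
  fin_cases j <;> fin_cases k <;> simp [corner]

theorem eq_of_corner_sub_eq : ∀ {j k j' k' : Fin 3}, corner j - corner k = corner j' - corner k' →
    corner j - corner k ≠ 0 → j = j' := by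
  decide

theorem corner_sub_not_diag : ∀ j k : Fin 3,
    corner j - corner k ≠ (1, 1) ∧ corner j - corner k ≠ (-1, -1) := by
  decide

theorem corner_injective : Function.Injective corner := by
  decide

/-- The point of the gasket coded by a sequence of digits. -/
def code (q : ℝ) (w : ℕ → Fin 3) : ℝ × ℝ :=
  (val q fun i => (corner (w i)).1, val q fun i => (corner (w i)).2)

theorem gasket_eq_range_code {q : ℝ} (hq : 1 < q) : gasket q = Set.range (code q) := by
  have key : ∀ w : ℕ → Fin 3, ∑' i, (q ^ (i + 1))⁻¹ •
      (((corner (w i)).1 : ℝ), ((corner (w i)).2 : ℝ)) = code q w := by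
    intro w
    refine HasSum.tsum_eq ?_
    have h1 := (summable_val hq fun i => (corner_mem (w i)).1).hasSum
    have h2 := (summable_val hq fun i => (corner_mem (w i)).2).hasSum
    have h := h1.prodMk h2
    simp only [div_eq_inv_mul] at h
    simpa only [code, val, div_eq_inv_mul, Prod.smul_mk, smul_eq_mul] using h
  ext x
  constructor
  · rintro ⟨c, hc, rfl⟩
    have : ∀ i, ∃ j, c i = (((corner j).1 : ℝ), ((corner j).2 : ℝ)) := by
      intro i
      rcases hc i with h | h | h
      · exact ⟨0, by simp [h, corner]⟩
      · exact ⟨1, by simp [h, corner]⟩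
      · exact ⟨2, by simp [Set.mem_singleton_iff.1 h, corner]⟩
    choose w hw using this
    exact ⟨w, by simp only [hw, key]⟩
  · rintro ⟨w, rfl⟩
    refine ⟨fun i => (((corner (w i)).1 : ℝ), ((corner (w i)).2 : ℝ)), fun i => ?_, (key w).symm⟩
    have : ∀ j, (((corner j).1 : ℝ), ((corner j).2 : ℝ)) ∈ Omega1 := fun j => by
      fin_cases j <;> simp [corner, Omega1]
    exact this (w i)

theorem val_sub {q : ℝ} (hq : 1 < q) {a b : ℕ → ℤ} (ha : ∀ i, a i ∈ ({-1, 0, 1} : Set ℤ))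
    (hb : ∀ i, b i ∈ ({-1, 0, 1} : Set ℤ)) :
    val q (fun i => a i - b i) = val q a - val q b := by
  simp only [val, Int.cast_sub, sub_div]
  exact (summable_val hq ha).tsum_sub (summable_val hq hb)

theorem code_sub {q : ℝ} (hq : 1 < q) (w w' : ℕ → Fin 3) :
    code q w - code q w' = (val q fun i => (corner (w i)).1 - (corner (w' i)).1,
      val q fun i => (corner (w i)).2 - (corner (w' i)).2) := by
  rw [val_sub hq (fun i => (corner_mem (w i)).1) fun i => (corner_mem (w' i)).1,
    val_sub hq (fun i => (corner_mem (w i)).2) fun i => (corner_mem (w' i)).2]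
  rfl

theorem abs_val_le {q : ℝ} (hq : 1 < q) {t : ℕ → ℤ} (ht : ∀ i, t i ∈ ({-1, 0, 1} : Set ℤ)) :
    |val q t| ≤ 1 / (q - 1) :=
  abs_le.2 ⟨neg_le_val hq ht, val_le hq ht⟩

theorem val_of_zero_initial {q : ℝ} (hq : 1 < q) {t : ℕ → ℤ}
    (ht : ∀ i, t i ∈ ({-1, 0, 1} : Set ℤ)) {m : ℕ} (h : ∀ i < m, t i = 0) :
    val q t = val q (fun i => t (m + i)) * (q ^ m)⁻¹ := by
  rw [val_split hq ht m, Finset.sum_eq_zero fun i hi => by simp [h i (Finset.mem_range.1 hi)],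
    zero_add, div_eq_mul_inv]

theorem abs_val_le_of_zero_initial {q : ℝ} (hq : 1 < q) {t : ℕ → ℤ}
    (ht : ∀ i, t i ∈ ({-1, 0, 1} : Set ℤ)) {m : ℕ} (h : ∀ i < m, t i = 0) :
    |val q t| ≤ 1 / (q - 1) * (q ^ m)⁻¹ := by
  rw [val_of_zero_initial hq ht h, abs_mul, abs_of_pos (by positivity : 0 < (q ^ m)⁻¹)]
  gcongr
  exact abs_val_le hq fun i => ht _

theorem le_abs_val_of_zero_initial {q : ℝ} (hq : 1 < q) {t : ℕ → ℤ}
    (ht : ∀ i, t i ∈ ({-1, 0, 1} : Set ℤ)) {m : ℕ} (h : ∀ i < m, t i = 0) (hm : t m ≠ 0) :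
    (1 - 1 / (q - 1)) / q * (q ^ m)⁻¹ ≤ |val q t| := by
  have hq0 : 0 < q := by linarith
  rw [val_of_zero_initial hq ht h, val_tail hq ht, abs_mul,
    abs_of_pos (by positivity : 0 < (q ^ m)⁻¹), abs_div, abs_of_pos hq0]
  gcongr
  have h1 := abs_val_le hq (t := fun i => t (m + 1 + i)) fun i => ht _
  have h2 : (1 : ℝ) ≤ |(t m : ℝ)| := by exact_mod_cast Int.one_le_abs hm
  have h3 := abs_sub_abs_le_abs_sub (t m : ℝ) (-val q fun i => t (m + 1 + i))
  rw [abs_neg, sub_neg_eq_add] at h3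
  linarith

theorem dimH_image_code_freeOn {q : ℝ} (hq : 2 < q) {p : ℕ → Prop} [DecidablePred p]
    (e : ℕ → Fin 3) {d : ℝ} (hp : CloseDens p d 0) :
    dimH (code q '' freeOn p e) = ENNReal.ofReal (d * (Real.log 3 / Real.log q)) := by
  have hq1 : 1 < q := by linarith
  have hqs : 1 < q - 1 := by linarith
  have hc : 0 < (1 - 1 / (q - 1)) / q :=
    div_pos (sub_pos.2 ((div_lt_one (by linarith)).2 hqs)) (by linarith)
  have hdist : ∀ w w', dist (code q w) (code q w') =
      max |val q fun i => (corner (w i)).1 - (corner (w' i)).1|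
        |val q fun i => (corner (w i)).2 - (corner (w' i)).2| := fun w w' => by
    rw [dist_eq_norm, code_sub hq1, Prod.norm_def]
    rfl
  refine le_antisymm
    (dimH_image_freeOn_le hq1 (C := 1 / (q - 1)) (by positivity) (fun w w' m h => ?_) e hp)
    (le_dimH_image_freeOn hq1 hc (fun w w' m h hm => ?_) e hp)
  · rw [hdist]
    exact max_le
      (abs_val_le_of_zero_initial hq1 (fun i => (corner_sub_mem _ _).1)
        fun i hi => by simp [h i hi])
      (abs_val_le_of_zero_initial hq1 (fun i => (corner_sub_mem _ _).2)
        fun i hi => by simp [h i hi])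
  · rw [hdist]
    by_cases h1 : (corner (w m)).1 - (corner (w' m)).1 = 0
    · have h2 : (corner (w m)).2 - (corner (w' m)).2 ≠ 0 := fun h2 =>
        hm (corner_injective (Prod.ext (sub_eq_zero.1 h1) (sub_eq_zero.1 h2)))
      exact le_max_of_le_right (le_abs_val_of_zero_initial hq1
        (t := fun i => (corner (w i)).2 - (corner (w' i)).2) (fun i => (corner_sub_mem _ _).2)
        (fun i hi => by simp [h i hi]) h2)
    · exact le_max_of_le_left (le_abs_val_of_zero_initial hq1
        (t := fun i => (corner (w i)).1 - (corner (w' i)).1) (fun i => (corner_sub_mem _ _).1)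
        (fun i hi => by simp [h i hi]) h1)

/-! ### Intersections with translates -/

theorem mem_uniqSet_iff {q s : ℝ} (hq : 1 < q) :
    s ∈ uniqSet q ↔ ∃ t ∈ uniqSeqSet q, val q t = s := by
  constructor
  · rintro ⟨-, t, ⟨ht, rfl⟩, huniq⟩
    have : ∀ i, ∃ n : ℤ, n ∈ ({-1, 0, 1} : Set ℤ) ∧ t i = n := by
      intro i
      rcases ht i with h | h | h
      · exact ⟨-1, by simp, by simp [h]⟩
      · exact ⟨0, by simp, by simp [h]⟩
      · exact ⟨1, by simp, by simp [Set.mem_singleton_iff.1 h]⟩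
    choose n hn hnt using this
    refine ⟨n, ⟨hn, fun s hs hsn => ?_⟩, by simp only [val, hnt]⟩
    have := huniq (fun i => s i) ⟨fun i => ?_, by simp only [hsn, hnt]⟩
    · funext i
      have := congrFun this i
      rw [hnt] at this
      exact_mod_cast this
    · rcases hs i with h | h | h
      · simp [h]
      · simp [h]
      · simp [Set.mem_singleton_iff.1 h]
  · rintro ⟨t, ht, rfl⟩
    refine ⟨⟨neg_le_val hq ht.1, val_le hq ht.1⟩, fun i => t i, ⟨fun i => ?_, rfl⟩, ?_⟩
    · rcases ht.1 i with h | h | h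
      · simp [h]
      · simp [h]
      · simp [Set.mem_singleton_iff.1 h]
    · rintro s ⟨hs, hst⟩
      have : ∀ i, ∃ n : ℤ, n ∈ ({-1, 0, 1} : Set ℤ) ∧ s i = n := by
        intro i
        rcases hs i with h | h | h
        · exact ⟨-1, by simp, by simp [h]⟩
        · exact ⟨0, by simp, by simp [h]⟩
        · exact ⟨1, by simp, by simp [Set.mem_singleton_iff.1 h]⟩
      choose n hn hns using this
      have := ht.2 n hn (by simp only [← hns]; exact hst.symm)
      funext i
      rw [hns, this]

theorem corner_sub_eq_of_code_sub {q : ℝ} (hq : 1 < q) {a b : ℕ → ℤ} (ha : a ∈ uniqSeqSet q)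
    (hb : b ∈ uniqSeqSet q) {w w' : ℕ → Fin 3} (h : code q w - code q w' = (val q a, val q b))
    (i : ℕ) : corner (w i) - corner (w' i) = (a i, b i) := by
  rw [code_sub hq, Prod.mk.injEq] at h
  have h1 := ha.2 _ (fun i => (corner_sub_mem (w i) (w' i)).1) h.1
  have h2 := hb.2 _ (fun i => (corner_sub_mem (w i) (w' i)).2) h.2
  exact Prod.ext (congrFun h1 i) (congrFun h2 i)

theorem code_sub_eq {q : ℝ} (hq : 1 < q) {a b : ℕ → ℤ} {w w' : ℕ → Fin 3}
    (h : ∀ i, corner (w i) - corner (w' i) = (a i, b i)) :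
    code q w - code q w' = (val q a, val q b) := by
  rw [code_sub hq]
  congr 2 <;> funext i
  · exact congrArg Prod.fst (h i)
  · exact congrArg Prod.snd (h i)

theorem gasket_inter_translate {q : ℝ} (hq : 1 < q) {a b : ℕ → ℤ} (ha : a ∈ uniqSeqSet q)
    (hb : b ∈ uniqSeqSet q) {w w' : ℕ → Fin 3}
    (hw : ∀ i, corner (w i) - corner (w' i) = (a i, b i)) :
    gasket q ∩ (· + (val q a, val q b)) '' gasket q =
      code q '' freeOn (fun i => a i = 0 ∧ b i = 0) w := by
  rw [gasket_eq_range_code hq]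
  ext x
  constructor
  · rintro ⟨⟨u, rfl⟩, _, ⟨u', rfl⟩, h⟩
    refine ⟨u, fun i hi => ?_, rfl⟩
    have hu := corner_sub_eq_of_code_sub hq ha hb (sub_eq_iff_eq_add'.2 h.symm) i
    refine eq_of_corner_sub_eq (hu.trans (hw i).symm) fun h0 => hi ?_
    rw [hu] at h0
    exact ⟨congrArg Prod.fst h0, congrArg Prod.snd h0⟩
  · rintro ⟨u, hu, rfl⟩
    refine ⟨⟨u, rfl⟩, _, ⟨fun i => if a i = 0 ∧ b i = 0 then u i else w' i, rfl⟩, ?_⟩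
    refine (sub_eq_iff_eq_add'.1 (code_sub_eq hq fun i => ?_)).symm
    split_ifs with h
    · rw [sub_self, h.1, h.2]
      rfl
    · rw [hu i h, hw i]

theorem Dset_subset {q : ℝ} (hq : 2 < q) (hq3 : q ≤ 3) (hval : val q klSeq = 1 - 1 / (q - 1)) :
    Dset q ⊆ (fun d => ENNReal.ofReal (d * (Real.log 3 / Real.log q))) '' densVals := by
  have hq1 : 1 < q := by linarith
  rintro _ ⟨⟨t₁, t₂⟩, ⟨ht, h1, h2⟩, rfl⟩
  obtain ⟨a, ha, rfl⟩ := (mem_uniqSet_iff hq1).1 h1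
  obtain ⟨b, hb, rfl⟩ := (mem_uniqSet_iff hq1).1 h2
  rw [gasket_eq_range_code hq1] at ht
  obtain ⟨_, ⟨w, rfl⟩, _, ⟨w', rfl⟩, hww'⟩ := Set.mem_sub.1 ht
  have hw := corner_sub_eq_of_code_sub hq1 ha hb hww'
  have hb' := uniqSeqSet.neg hb
  obtain ⟨d, hd, hdens⟩ := exists_closeDens_joint
    ((klAdm_of_mem_uniqSeqSet hq1 hq3 hval ha).jumpShape ha.1)
    ((klAdm_of_mem_uniqSeqSet hq1 hq3 hval hb').jumpShape hb'.1) (fun i => by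
      have := corner_sub_not_diag (w i) (w' i)
      rw [hw i] at this
      refine ⟨fun h => this.1 (Prod.ext h.1 ?_), fun h => this.2 (Prod.ext h.1 ?_)⟩
      · simpa using h.2
      · have := h.2
        dsimp only at this ⊢
        omega)
  refine ⟨d, hd, ?_⟩
  rw [gasket_inter_translate hq1 ha hb hw]
  exact (dimH_image_code_freeOn hq w (hdens.of_eventually_iff le_rfl 0 fun i _ => by simp)).symm

/-- The dimension given by the density of zeros of a strictly admissible sequence is attained. -/
theorem StrictLexAdm.mem_Dset {q : ℝ} (hq : 2 < q) (hval : val q klSeq = 1 - 1 / (q - 1))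
    {s : ℕ → Bool} (hs : StrictLexAdm s) {d : ℝ}
    (hd : CloseDens (fun i => s (i + 1) = s i) d 0) :
    ENNReal.ofReal (d * (Real.log 3 / Real.log q)) ∈ Dset q := by
  have hq1 : 1 < q := by linarith
  have ha := hs.strictKLAdm.mem_uniqSeqSet hq1 hval fun i => jump_mem s i
  have hb := strictLexAdm_const.strictKLAdm.mem_uniqSeqSet hq1 hval fun i => jump_mem _ i
  have hw : ∀ i, corner (if s (i + 1) then 2 else 0) - corner (if s i then 2 else 0) =
      (jump s i, jump (fun _ => false) i) := by
    intro i
    cases h : s (i + 1) <;> cases h' : s i <;> simp [jump, corner, h, h', Prod.zero_eq_mk]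
  refine ⟨(val q (jump s), val q (jump fun _ => false)), ⟨?_, ?_, ?_⟩, ?_⟩
  · rw [gasket_eq_range_code hq1, ← code_sub_eq hq1 hw]
    exact Set.sub_mem_sub ⟨_, rfl⟩ ⟨_, rfl⟩
  · exact (mem_uniqSet_iff hq1).2 ⟨_, ha, rfl⟩
  · exact (mem_uniqSet_iff hq1).2 ⟨_, hb, rfl⟩
  · rw [gasket_inter_translate hq1 ha hb hw]
    refine (dimH_image_code_freeOn hq _ (hd.of_eventually_iff le_rfl 0 fun i _ => ?_)).symm
    rw [jump_eq_zero_iff, jump_eq_zero_iff]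
    simp

theorem exists_strictLexAdm_closeDens {d : ℝ} (hd : d ∈ densVals) :
    ∃ s, StrictLexAdm s ∧ CloseDens (fun i => s (i + 1) = s i) d 0 := by
  rcases hd with (rfl | rfl) | ⟨n, rfl⟩
  · exact ⟨_, strictLexAdm_const, CloseDens.one_of_eventually 0 fun i _ => rfl⟩
  · exact ⟨_, strictLexAdm_thueMorse, closeDens_thueMorse⟩
  · induction n with
    | zero =>
      refine ⟨_, strictLexAdm_alternating, ?_⟩
      rw [altSum_zero]
      refine CloseDens.zero_of_eventually_not 0 fun i _ => ?_
      rw [decide_eq_decide]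
      omega
    | succ n ih =>
      obtain ⟨s, hs, hsd⟩ := ih
      refine ⟨_, hs.double, ?_⟩
      have := hsd.double le_rfl
      rwa [← altSum_succ, zero_div] at this

theorem Dset_eq_image {q : ℝ} (hq : 2 < q) (hq3 : q ≤ 3)
    (hval : val q klSeq = 1 - 1 / (q - 1)) :
    Dset q = (fun d => ENNReal.ofReal (d * (Real.log 3 / Real.log q))) '' densVals := by
  refine (Dset_subset hq hq3 hval).antisymm ?_
  rintro _ ⟨d, hd, rfl⟩
  obtain ⟨s, hs, hsd⟩ := exists_strictLexAdm_closeDens hd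
  exact hs.mem_Dset hq hval hsd

theorem stmt1 (q : ℝ) (hq1 : 1 < q) (hq2 : uniqueOneExp q)
    (hq3 : ∀ p, 1 < p → uniqueOneExp p → q ≤ p) :
    Dset q = {0, ENNReal.ofReal (Real.log 3 / Real.log q),
        ENNReal.ofReal (Real.log 3 / (3 * Real.log q))} ∪
      {d : ℝ≥0∞ | ∃ n, 1 ≤ n ∧
        d = ENNReal.ofReal (-(Real.log 3 / Real.log q) *
              ∑ i ∈ Finset.Icc 1 n, (-(1 / 2) : ℝ) ^ i)} := by
  obtain ⟨hlt, hle, hval⟩ := base_eq_komornikLoreti hq1 hq2 hq3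
  rw [Dset_eq_image hlt hle hval]
  have halt : ∀ n, altSum n * (Real.log 3 / Real.log q) =
      -(Real.log 3 / Real.log q) * ∑ i ∈ Finset.Icc 1 n, (-(1 / 2) : ℝ) ^ i := fun n => by
    rw [altSum]
    ring
  have hthird : 1 / 3 * (Real.log 3 / Real.log q) = Real.log 3 / (3 * Real.log q) := by
    rw [div_mul_div_comm, one_mul]
  ext x
  constructor
  · rintro ⟨d, (rfl | rfl) | ⟨n, rfl⟩, rfl⟩
    · exact Or.inl (Or.inr (Or.inl (by simp)))
    · exact Or.inl (Or.inr (Or.inr (congrArg ENNReal.ofReal hthird)))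
    · rcases Nat.eq_zero_or_pos n with rfl | hn
      · exact Or.inl (Or.inl (by simp [altSum_zero]))
      · exact Or.inr ⟨n, hn, congrArg ENNReal.ofReal (halt n)⟩
  · rintro ((rfl | rfl | rfl) | ⟨n, -, rfl⟩)
    · exact ⟨0, zero_mem_densVals, by simp⟩
    · exact ⟨1, Or.inl (Or.inl rfl), by simp⟩
    · exact ⟨1 / 3, Or.inl (Or.inr rfl), congrArg ENNReal.ofReal hthird⟩
    · exact ⟨altSum n, Or.inr ⟨n, rfl⟩, congrArg ENNReal.ofReal (halt n)⟩

end
end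

section
/- Let n≥1 and 0<i<2^{n+1} with i≠2^n. If i is odd, then the sequence E_{n,n}^i contains no occurrence of (0,0). If i is even, then E_{n,n}^i∉Ω2^ℕ. -/
open scoped Pointwise ENNReal
open Filter

noncomputable section

theorem tm_two_mul (k : ℕ) : tm (2 * k) = tm k := by
  cases k with
  | zero => rfl
  | succ m =>
    rw [show 2 * (m + 1) = (2 * m + 1) + 1 by ring, tm, if_pos (by omega)]
    congr 1
    omega

theorem tm_two_mul_add_one (k : ℕ) : tm (2 * k + 1) = 1 - tm k := by
  rw [tm, if_neg (by omega)]
  congr 2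
  omega

theorem tm_le_one (k : ℕ) : tm k ≤ 1 := by
  obtain ⟨m, rfl | rfl⟩ := Nat.even_or_odd' k
  · rcases Nat.eq_zero_or_pos m with rfl | hm
    · simp [tm]
    · rw [tm_two_mul]
      exact tm_le_one m
  · rw [tm_two_mul_add_one]
    exact Nat.sub_le _ _
termination_by k

theorem lam_two_mul_add_one (k : ℕ) : lam (2 * k + 1) = 1 ∨ lam (2 * k + 1) = -1 := by
  have h := tm_le_one k
  simp only [lam, Nat.add_sub_cancel, tm_two_mul_add_one, tm_two_mul]
  omega

theorem per_append_reflect_antiperiodic (w : List ℤ) :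
    Function.Antiperiodic (per (w ++ reflect w)) w.length := by
  intro j
  rcases Nat.eq_zero_or_pos w.length with h0 | h0
  · simp [per, List.length_eq_zero_iff.mp h0, reflect]
  have hlen : (reflect w).length = w.length := by simp [reflect]
  have hgetD (k : ℕ) : (reflect w).getD k 0 = -w.getD k 0 := by
    simp only [reflect, List.getD_eq_getElem?_getD, List.getElem?_map]
    cases w[k]? <;> simp
  simp only [per, List.length_append, hlen]
  set L := w.length
  have hlt := Nat.mod_lt j (show 0 < L + L by omega)
  by_cases h : j % (L + L) < L
  · have hmod : (j + L) % (L + L) = j % (L + L) + L := by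
      rw [Nat.add_mod, Nat.mod_eq_of_lt (show L < L + L by omega), Nat.mod_eq_of_lt (by omega)]
    rw [hmod, List.getD_append_right _ _ _ _ (by omega), List.getD_append _ _ _ _ h, hgetD]
    congr 2
    omega
  · have hmod : (j + L) % (L + L) = j % (L + L) - L := by
      rw [Nat.add_mod, Nat.mod_eq_of_lt (show L < L + L by omega),
        Nat.mod_eq_sub_mod (by omega), Nat.mod_eq_of_lt (by omega)]
      omega
    rw [hmod, List.getD_append _ _ _ _ (by omega),
      List.getD_append_right _ _ _ _ (by omega), hgetD, neg_neg]

theorem eps_length (n : ℕ) : (eps n).length = 2 ^ n := by simp [eps]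

theorem eps_getD (n k : ℕ) (hk : k < 2 ^ n) : (eps n).getD k 0 = lam (k + 1) := by
  simp [eps, List.getD_eq_getElem?_getD, hk]

theorem per_eps_antiperiodic (n : ℕ) :
    Function.Antiperiodic (per (eps n ++ reflect (eps n))) (2 ^ n) := by
  simpa only [eps_length] using per_append_reflect_antiperiodic (eps n)

theorem per_eps_of_lt (n k : ℕ) (hk : k < 2 ^ n) :
    per (eps n ++ reflect (eps n)) k = lam (k + 1) := by
  have hlen : (eps n ++ reflect (eps n)).length = 2 ^ n + 2 ^ n := by simp [eps_length, reflect]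
  rw [per, hlen, Nat.mod_eq_of_lt (by omega),
    List.getD_append _ _ _ _ (by rwa [eps_length]), eps_getD n k hk]

/-- The terms of `(ε_n ε̄_n)^∞` at even (zero-based) positions are `±1`. -/
theorem per_eps_two_mul {n : ℕ} (hn : 1 ≤ n) (k : ℕ) :
    per (eps n ++ reflect (eps n)) (2 * k) = 1 ∨
      per (eps n ++ reflect (eps n)) (2 * k) = -1 := by
  obtain ⟨r, rfl⟩ := Nat.exists_eq_add_of_le' hn
  have hpow : 2 ^ (r + 1) = 2 * 2 ^ r := by ring
  induction k using Nat.strong_induction_on with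
  | _ k ih =>
    rcases lt_or_ge k (2 ^ r) with hk | hk
    · rw [per_eps_of_lt _ _ (by omega)]
      exact lam_two_mul_add_one k
    · have hstep := per_eps_antiperiodic (r + 1) (2 * (k - 2 ^ r))
      rw [show 2 * (k - 2 ^ r) + 2 ^ (r + 1) = 2 * k by omega] at hstep
      have := ih (k - 2 ^ r) (by have := Nat.two_pow_pos r; omega)
      omega

/-- The only antiperiod in `(0, 2 ^ (r + 1))` of a sequence with antiperiod `2 ^ r` and a nonzero
term is `2 ^ r` itself. -/
theorem eq_two_pow_of_antiperiodic {f : ℕ → ℤ} {r m k : ℕ} (hk : f k ≠ 0)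
    (hr : Function.Antiperiodic f (2 ^ r)) (hm : Function.Antiperiodic f m)
    (h0 : 0 < m) (h1 : m < 2 * 2 ^ r) : m = 2 ^ r := by
  obtain ⟨s, o, ho, rfl⟩ := Nat.exists_eq_two_pow_mul_odd h0.ne'
  rcases le_or_gt r s with hs | hs
  · obtain ⟨d, rfl⟩ := Nat.exists_eq_add_of_le hs
    have hc : 2 ^ d * o < 2 := by
      have : 2 ^ r * (2 ^ d * o) < 2 ^ r * 2 := by rw [← mul_assoc, ← pow_add]; omega
      exact lt_of_mul_lt_mul_left this (Nat.zero_le _)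
    have hpos : 0 < 2 ^ d * o := Nat.mul_pos (Nat.two_pow_pos d) ho.pos
    rw [pow_add, mul_assoc, show 2 ^ d * o = 1 by omega, mul_one]
  · exfalso
    obtain ⟨d, rfl⟩ := Nat.exists_eq_add_of_lt hs
    obtain ⟨e, rfl⟩ := ho
    have hanti := hr.nat_odd_mul_antiperiodic e k
    have hper := hm.nat_even_mul_periodic (2 ^ d) k
    have heq : 2 ^ d * (2 * (2 ^ s * (2 * e + 1))) =
        e * (2 * 2 ^ (s + d + 1)) + 2 ^ (s + d + 1) := by
      rw [show s + d + 1 = (s + d) + 1 by rfl, pow_succ, pow_add]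
      ring
    simp only [Nat.cast_id] at hanti hper
    rw [heq] at hper
    omega

theorem stmt8 (n i : ℕ) (hn : 1 ≤ n) (hi0 : 0 < i) (hi1 : i < 2 ^ (n + 1))
    (hi2 : i ≠ 2 ^ n) :
    (i % 2 = 1 → ∀ j, Eseq n n i j ≠ (0, 0)) ∧
      (i % 2 = 0 → ∃ j, Eseq n n i j ∉ Omega2Z) := by
  refine ⟨fun hodd j hj => ?_, fun heven => ?_⟩
  · obtain ⟨h1, h2⟩ := Prod.mk.inj hj
    obtain ⟨k, rfl | rfl⟩ := Nat.even_or_odd' j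
    · have := per_eps_two_mul hn k
      omega
    · have := per_eps_two_mul hn ((2 * k + 1 + i) / 2)
      rw [show 2 * ((2 * k + 1 + i) / 2) = 2 * k + 1 + i by omega] at this
      omega
  · by_contra! hall
    obtain ⟨m, rfl⟩ := Nat.dvd_of_mod_eq_zero heven
    obtain ⟨r, rfl⟩ := Nat.exists_eq_add_of_le' hn
    have hpow : 2 ^ (r + 1) = 2 * 2 ^ r := by ring
    have hpow' : 2 ^ (r + 1 + 1) = 2 * 2 ^ (r + 1) := by ring
    have hunit := per_eps_two_mul hn
    have hanti := per_eps_antiperiodic (r + 1)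
    simp only [Eseq] at hall
    set x := per (eps (r + 1) ++ reflect (eps (r + 1)))
    have hm : m = 2 ^ r := by
      refine eq_two_pow_of_antiperiodic (f := fun k => x (2 * k)) (k := 0) ?_ ?_ ?_
        (by omega) (by omega)
      · have := hunit 0
        omega
      · intro k
        dsimp only
        rw [mul_add, ← hpow]
        exact hanti _
      · intro k
        have hk := hall (2 * k)
        have h1 := hunit k
        have h2 := hunit (k + m)
        dsimp only
        rw [mul_add] at h2 ⊢
        simp only [Omega2Z, Set.mem_insert_iff, Set.mem_singleton_iff, Prod.mk.injEq] at hk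
        omega
    omega

end
end
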